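/- arXiv:1808.04777 — 9 statements merged into one kernel-verified Lean document; each statement's English description precedes it below -/
import Mathlib

section
/- Hardy–Poincaré computation (Lemma 8.6, radial form): let γ : (0,∞) → ℝ be smooth and m > 0. For every test function u, ∫ γ |u′ + ρ coth(r) u|² dμ_d = ∫ γ |u′ + ρ coth(r) u − m r^{−1} u|² dμ_d + m ∫ ((1−m) γ(r) − r γ′(r)) r^{−2} |u|² dμ_d. -/
open MeasureTheory Set

/-- A radial test function: a smooth function on `ℝ` with compact support
contained in `(0, ∞)`. -/
def IsTestFun (v : ℝ → ℂ) : Prop :=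
  ContDiff ℝ (⊤ : ℕ∞) v ∧ HasCompactSupport v ∧ tsupport v ⊆ Set.Ioi (0 : ℝ)

/-- The hyperbolic cotangent. -/
noncomputable def cothR (r : ℝ) : ℝ := Real.cosh r / Real.sinh r

/-- `ρ = (d-1)/2`. -/
noncomputable def rho (d : ℕ) : ℝ := ((d : ℝ) - 1) / 2

theorem integrable_of_continuousOn_of_eq_zero {u : ℝ → ℂ} (hu : IsTestFun u) {f : ℝ → ℝ}
    (hf : ContinuousOn f (Ioi 0)) (h0 : ∀ r ∉ tsupport u, f r = 0) : Integrable f := by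
  rw [← integrableOn_iff_integrable_of_support_subset (s := tsupport u)]
  · exact (hf.mono hu.2.2).integrableOn_compact hu.2.1
  · intro r hr
    by_contra h
    exact hr (h0 r h)

/-- The derivative of `γ(r) r⁻¹ |u|² sinh(r)^(k+1)` on `(0, ∞)`. -/
theorem hasDerivAt_weight_mul_normSq {γ : ℝ → ℝ} {u : ℝ → ℂ} {r : ℝ} (hr : 0 < r) (k : ℕ)
    (hγ : DifferentiableAt ℝ γ r) (hu : DifferentiableAt ℝ u r) :
    HasDerivAt (fun r => γ r * r⁻¹ * ‖u r‖ ^ 2 * Real.sinh r ^ (k + 1))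
      (((deriv γ r * r⁻¹ + γ r * (-(r ^ 2)⁻¹)) * ‖u r‖ ^ 2
          + γ r * r⁻¹ * (2 * inner ℝ (u r) (deriv u r))) * Real.sinh r ^ (k + 1)
        + γ r * r⁻¹ * ‖u r‖ ^ 2 * ((k + 1) * Real.sinh r ^ k * Real.cosh r)) r := by
  have h := ((hγ.hasDerivAt.mul (hasDerivAt_inv hr.ne')).mul hu.hasDerivAt.norm_sq).mul
    ((Real.hasDerivAt_sinh r).pow (k + 1))
  refine h.congr_deriv ?_
  simp

/-- Completing the square, with the cross term written as a total derivative. -/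
theorem weight_mul_norm_sq_eq (g g' m r s c : ℝ) (k : ℕ) (z w : ℂ) (hr : r ≠ 0) (hs : s ≠ 0) :
    g * ‖w + ((((k + 2 : ℕ) : ℝ) - 1) / 2 * (c / s) : ℝ) * z‖ ^ 2 * s ^ (k + 1)
      = g * ‖w + ((((k + 2 : ℕ) : ℝ) - 1) / 2 * (c / s) : ℝ) * z
            - ((m * r⁻¹ : ℝ) : ℂ) * z‖ ^ 2 * s ^ (k + 1)
        + m * (((1 - m) * g - r * g') * (r ^ 2)⁻¹ * ‖z‖ ^ 2 * s ^ (k + 1))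
        + m * (((g' * r⁻¹ + g * (-(r ^ 2)⁻¹)) * ‖z‖ ^ 2
          + g * r⁻¹ * (2 * inner ℝ z w)) * s ^ (k + 1)
          + g * r⁻¹ * ‖z‖ ^ 2 * ((k + 1) * s ^ k * c)) := by
  simp only [Complex.sq_norm, Complex.normSq_apply, Complex.inner, Complex.add_re,
    Complex.add_im, Complex.sub_re, Complex.sub_im, Complex.ofReal_re, Complex.ofReal_im,
    Complex.mul_re, Complex.mul_im, Complex.conj_re, Complex.conj_im]
  push_cast
  field_simp
  ring

/-- **Hardy–Poincaré computation** (Lemma 8.6, radial form): for a smooth weight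
`γ` on `(0,∞)`, `m > 0`, and every test function `u`,
`∫ γ |u′ + ρ coth(r) u|² dμ_d
  = ∫ γ |u′ + ρ coth(r) u − m r⁻¹ u|² dμ_d
    + m ∫ ((1−m) γ(r) − r γ′(r)) r⁻² |u|² dμ_d`. -/
theorem hardy_poincare_computation (d : ℕ) (hd : 2 ≤ d)
    (γ : ℝ → ℝ) (hγ : ContDiffOn ℝ (⊤ : ℕ∞) γ (Ioi (0 : ℝ)))
    (m : ℝ) (hm : 0 < m)
    (u : ℝ → ℂ) (hu : IsTestFun u) :
    (∫ r in Ioi (0 : ℝ),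
        γ r * ‖deriv u r + ((rho d * cothR r : ℝ) : ℂ) * u r‖ ^ 2
          * Real.sinh r ^ (d - 1))
      = (∫ r in Ioi (0 : ℝ),
          γ r * ‖deriv u r + ((rho d * cothR r : ℝ) : ℂ) * u r
              - ((m * r⁻¹ : ℝ) : ℂ) * u r‖ ^ 2 * Real.sinh r ^ (d - 1))
        + m * ∫ r in Ioi (0 : ℝ),
            ((1 - m) * γ r - r * deriv γ r) * (r ^ 2)⁻¹ * ‖u r‖ ^ 2
              * Real.sinh r ^ (d - 1) := by
  obtain ⟨k, rfl⟩ := Nat.exists_eq_add_of_le' hd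
  simp only [show k + 2 - 1 = k + 1 from rfl]
  have hu0 : ∀ r ∉ tsupport u, u r = 0 := fun r hr => image_eq_zero_of_notMem_tsupport hr
  have hdu0 : ∀ r ∉ tsupport u, deriv u r = 0 := fun r hr => by
    by_contra h
    exact hr (support_deriv_subset h)
  have hud : Differentiable ℝ u := hu.1.differentiable (by simp)
  have hγd : ∀ r ∈ Ioi (0 : ℝ), DifferentiableAt ℝ γ r := fun r hr =>
    (hγ.differentiableOn (by simp)).differentiableAt (Ioi_mem_nhds hr)
  have cu : ContinuousOn u (Ioi 0) := hud.continuous.continuousOn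
  have cdu : ContinuousOn (deriv u) (Ioi 0) := (hu.1.continuous_deriv (by simp)).continuousOn
  have cγ : ContinuousOn γ (Ioi 0) := hγ.continuousOn
  have cdγ : ContinuousOn (deriv γ) (Ioi 0) :=
    hγ.continuousOn_deriv_of_isOpen isOpen_Ioi (by simp)
  have cinv : ContinuousOn (fun r : ℝ => r⁻¹) (Ioi 0) :=
    continuousOn_inv₀.mono fun r hr => (ne_of_gt hr : r ≠ 0)
  have cinv2 : ContinuousOn (fun r : ℝ => (r ^ 2)⁻¹) (Ioi 0) :=
    (continuousOn_id.pow 2).inv₀ fun r hr => pow_ne_zero 2 (ne_of_gt hr)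
  have csinh : ContinuousOn Real.sinh (Ioi 0) := Real.continuous_sinh.continuousOn
  have ccosh : ContinuousOn Real.cosh (Ioi 0) := Real.continuous_cosh.continuousOn
  have ccoth : ContinuousOn cothR (Ioi 0) :=
    ccosh.div csinh fun r hr => (Real.sinh_pos_iff.2 hr).ne'
  let F : ℝ → ℝ := fun r => γ r * r⁻¹ * ‖u r‖ ^ 2 * Real.sinh r ^ (k + 1)
  let F' : ℝ → ℝ := fun r => ((deriv γ r * r⁻¹ + γ r * (-(r ^ 2)⁻¹)) * ‖u r‖ ^ 2
          + γ r * r⁻¹ * (2 * inner ℝ (u r) (deriv u r))) * Real.sinh r ^ (k + 1)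
        + γ r * r⁻¹ * ‖u r‖ ^ 2 * ((k + 1) * Real.sinh r ^ k * Real.cosh r)
  have hF'0 : ∀ r ∉ tsupport u, F' r = 0 := fun r hr => by simp [F', hu0 r hr]
  have hF : ∀ r, HasDerivAt F (F' r) r := by
    intro r
    by_cases hr : r ∈ tsupport u
    · exact hasDerivAt_weight_mul_normSq (hu.2.2 hr) k (hγd r (hu.2.2 hr)) (hud r)
    · rw [hF'0 r hr]
      refine (hasDerivAt_const r (0 : ℝ)).congr_of_eventuallyEq ?_
      filter_upwards [(isClosed_tsupport u).isOpen_compl.mem_nhds hr] with x hx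
      simp [F, hu0 x hx]
  have iF : Integrable F := integrable_of_continuousOn_of_eq_zero hu
    (by fun_prop) fun r hr => by simp [F, hu0 r hr]
  have iF' : Integrable F' := integrable_of_continuousOn_of_eq_zero hu
    (by fun_prop) hF'0
  have hF'int : ∫ r in Ioi (0 : ℝ), F' r = 0 := by
    rw [setIntegral_eq_integral_of_forall_compl_eq_zero
      fun r hr => hF'0 r fun h => hr (hu.2.2 h)]
    exact integral_eq_zero_of_hasDerivAt_of_integrable hF iF' iF
  have iB : Integrable fun r => γ r * ‖deriv u r + ((rho (k + 2) * cothR r : ℝ) : ℂ) * u r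
      - ((m * r⁻¹ : ℝ) : ℂ) * u r‖ ^ 2 * Real.sinh r ^ (k + 1) :=
    integrable_of_continuousOn_of_eq_zero hu (by fun_prop)
      fun r hr => by simp [hu0 r hr, hdu0 r hr]
  have iC : Integrable fun r => ((1 - m) * γ r - r * deriv γ r) * (r ^ 2)⁻¹ * ‖u r‖ ^ 2
      * Real.sinh r ^ (k + 1) :=
    integrable_of_continuousOn_of_eq_zero hu (by fun_prop) fun r hr => by simp [hu0 r hr]
  have iBC := iB.integrableOn (s := Ioi 0) |>.add (iC.integrableOn.const_mul m)
  have hA := setIntegral_congr_fun (μ := volume) measurableSet_Ioi fun r (hr : r ∈ Ioi (0 : ℝ)) =>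
    weight_mul_norm_sq_eq (γ r) (deriv γ r) m r (Real.sinh r) (Real.cosh r) k (u r) (deriv u r)
      (ne_of_gt hr) (Real.sinh_pos_iff.2 hr).ne'
  refine hA.trans ((integral_add iBC (iF'.integrableOn.const_mul m)).trans ?_)
  rw [integral_const_mul, hF'int, mul_zero, add_zero]
  refine (integral_add iB.integrableOn (iC.integrableOn.const_mul m)).trans ?_
  rw [integral_const_mul]
end

section
/- Weighted Hardy–Poincaré inequality (Lemma 5.2, inequality (5.2), radial form): let w : (0,∞) → [0,∞) be smooth and nonnegative. For every test function u, ∫ w (|u′|² − ρ² |u|²) dμ_d − ρ ∫ coth(r) w′(r) |u|² dμ_d ≥ ∫ U w |u|² dμ_d − ∫ (w′(r)/(2r)) |u|² dμ_d. -/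
open MeasureTheory Set

/-- The potential `U` from the weighted Hardy–Poincaré inequality:
`U(r) = (1/4) r⁻² + ((d−1)(d−3)/4) sinh(r)⁻²` for `d ≥ 3`, and
`U(r) = (1/4)(r⁻² − sinh(r)⁻²)` for `d = 2`. -/
noncomputable def Upot (d : ℕ) (r : ℝ) : ℝ :=
  if d = 2 then (1 / 4) * ((r ^ 2)⁻¹ - (Real.sinh r ^ 2)⁻¹)
  else (1 / 4) * (r ^ 2)⁻¹ + (((d : ℝ) - 1) * ((d : ℝ) - 3) / 4) * (Real.sinh r ^ 2)⁻¹

/-- A function continuous on `(0, ∞)` and supported in the support of a test function is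
integrable on `(0, ∞)`. -/
theorem IsTestFun.integrableOn_of_support_subset {u : ℝ → ℂ} (hu : IsTestFun u) {f : ℝ → ℝ}
    (hf : ContinuousOn f (Ioi 0)) (hsupp : Function.support f ⊆ tsupport u) :
    IntegrableOn f (Ioi 0) := by
  have hts : tsupport f ⊆ tsupport u := closure_minimal hsupp (isClosed_tsupport u)
  have hcont : Continuous f := continuous_of_tsupport fun x hx =>
    hf.continuousAt (Ioi_mem_nhds (hu.2.2 (hts hx)))
  exact (hcont.integrable_of_hasCompactSupport
    (hu.2.1.of_isClosed_subset (isClosed_tsupport f) hts)).integrableOn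

theorem IsTestFun.integrableOn_mul_norm_sq_mul {u : ℝ → ℂ} (hu : IsTestFun u) {f g : ℝ → ℝ}
    (hf : ContinuousOn f (Ioi 0)) (hg : ContinuousOn g (Ioi 0)) :
    IntegrableOn (fun r => f r * ‖u r‖ ^ 2 * g r) (Ioi 0) := by
  have huc : Continuous u := hu.1.continuous
  refine hu.integrableOn_of_support_subset (by fun_prop) fun x hx => subset_tsupport u ?_
  intro h
  simp [h] at hx

/-- The integral over `(0, ∞)` of the derivative of `g ‖u‖²` vanishes for a test function `u`. -/
theorem IsTestFun.integral_deriv_mul_norm_sq {u : ℝ → ℂ} (hu : IsTestFun u) {g : ℝ → ℝ}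
    (hg : ContDiffOn ℝ 1 g (Ioi 0)) :
    IntegrableOn (deriv fun r => g r * ‖u r‖ ^ 2) (Ioi 0) ∧
      ∫ r in Ioi (0 : ℝ), deriv (fun r => g r * ‖u r‖ ^ 2) r = 0 := by
  have hsupp : Function.support (fun r => g r * ‖u r‖ ^ 2) ⊆ tsupport u := by
    refine fun x hx => subset_tsupport u ?_
    intro h
    simp [h] at hx
  have hts := closure_minimal hsupp (isClosed_tsupport u)
  have hu1 : ContDiff ℝ 1 u := hu.1.of_le (by exact_mod_cast le_top)
  have hF : ContDiff ℝ 1 (fun r => g r * ‖u r‖ ^ 2) := contDiff_iff_contDiffAt.mpr fun x => by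
    by_cases hx : x ∈ tsupport fun r => g r * ‖u r‖ ^ 2
    · exact (hg.contDiffAt (Ioi_mem_nhds (hu.2.2 (hts hx)))).mul (hu1.norm_sq ℝ).contDiffAt
    · exact contDiffAt_const.congr_of_eventuallyEq (notMem_tsupport_iff_eventuallyEq.mp hx)
  have hFc : HasCompactSupport (fun r => g r * ‖u r‖ ^ 2) :=
    hu.2.1.of_isClosed_subset (isClosed_tsupport _) hts
  refine ⟨((hF.continuous_deriv le_rfl).integrable_of_hasCompactSupport hFc.deriv).integrableOn, ?_⟩
  have h0 : u 0 = 0 := image_eq_zero_of_notMem_tsupport fun h => lt_irrefl (0 : ℝ) (hu.2.2 h)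
  rw [hFc.integral_Ioi_deriv_eq hF 0, h0]
  simp

/-- The two cases in the definition of `U` agree: the formula for `d ≥ 3` also holds for `d = 2`. -/
theorem Upot_eq (d : ℕ) (r : ℝ) :
    Upot d r = 1 / 4 * (r ^ 2)⁻¹ + (rho d ^ 2 - rho d) * (Real.sinh r ^ 2)⁻¹ := by
  unfold Upot rho
  split_ifs with h
  · subst h
    push_cast
    ring
  · ring

theorem hasDerivAt_cothR {r : ℝ} (hr : r ≠ 0) :
    HasDerivAt cothR (-(Real.sinh r ^ 2)⁻¹) r := by
  have hs : Real.sinh r ≠ 0 := Real.sinh_ne_zero.mpr hr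
  refine ((Real.hasDerivAt_cosh r).div (Real.hasDerivAt_sinh r) hs).congr_deriv ?_
  field_simp
  linear_combination -Real.cosh_sq r

/-- The logarithmic derivative of `r ^ (1/2) * sinh r ^ (-ρ)`. -/
noncomputable def hardyDrift (d : ℕ) (r : ℝ) : ℝ := (2 * r)⁻¹ - rho d * cothR r

theorem hasDerivAt_hardyDrift (d : ℕ) {r : ℝ} (hr : r ≠ 0) :
    HasDerivAt (hardyDrift d) (rho d * (Real.sinh r ^ 2)⁻¹ - (2 * r ^ 2)⁻¹) r := by
  refine ((((hasDerivAt_id' r).const_mul 2).inv (mul_ne_zero two_ne_zero hr)).sub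
    ((hasDerivAt_cothR hr).const_mul (rho d))).congr_deriv ?_
  field_simp
  ring

theorem hasDerivAt_sinh_pow {d : ℕ} (hd : 1 ≤ d) {r : ℝ} (hr : r ≠ 0) :
    HasDerivAt (fun r => Real.sinh r ^ (d - 1))
      (2 * rho d * cothR r * Real.sinh r ^ (d - 1)) r := by
  have hs : Real.sinh r ≠ 0 := Real.sinh_ne_zero.mpr hr
  obtain ⟨n, rfl⟩ := Nat.exists_eq_add_of_le' hd
  refine ((Real.hasDerivAt_sinh r).pow n).congr_deriv ?_
  rcases n with _ | m
  · simp [rho]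
  · simp only [rho, cothR, Nat.add_sub_cancel]
    push_cast
    field_simp
    ring

theorem contDiffOn_hardyDrift (d : ℕ) : ContDiffOn ℝ 1 (hardyDrift d) (Ioi 0) := by
  unfold hardyDrift cothR
  intro r hr
  have hr0 : r ≠ 0 := ne_of_gt hr
  have hs : Real.sinh r ≠ 0 := Real.sinh_ne_zero.mpr hr0
  refine ContDiffAt.contDiffWithinAt ?_
  refine ((contDiffAt_const.mul contDiffAt_id).inv (mul_ne_zero two_ne_zero hr0)).sub
    (contDiffAt_const.mul ?_)
  exact Real.contDiff_cosh.contDiffAt.div Real.contDiff_sinh.contDiffAt hs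

/-- Completing the square: the difference of the two sides of the weighted Hardy–Poincaré
inequality dominates, pointwise, an exact derivative. -/
theorem deriv_le_hardy_integrand {d : ℕ} (hd : 1 ≤ d) {w : ℝ → ℝ} {u : ℝ → ℂ} {r : ℝ}
    (hr : 0 < r) (hw : DifferentiableAt ℝ w r) (hw0 : 0 ≤ w r) (hu : DifferentiableAt ℝ u r) :
    deriv (fun r => (w r * Real.sinh r ^ (d - 1) * hardyDrift d r) * ‖u r‖ ^ 2) r ≤
      (w r * (‖deriv u r‖ ^ 2 - rho d ^ 2 * ‖u r‖ ^ 2) * Real.sinh r ^ (d - 1)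
          - rho d * (cothR r * deriv w r * ‖u r‖ ^ 2 * Real.sinh r ^ (d - 1)))
        - (Upot d r * w r * ‖u r‖ ^ 2 * Real.sinh r ^ (d - 1)
          - (deriv w r / (2 * r)) * ‖u r‖ ^ 2 * Real.sinh r ^ (d - 1)) := by
  have hr0 : r ≠ 0 := hr.ne'
  have hs : 0 < Real.sinh r := Real.sinh_pos_iff.mpr hr
  have hF := ((hw.hasDerivAt.mul (hasDerivAt_sinh_pow hd hr0)).mul
    (hasDerivAt_hardyDrift d hr0)).mul hu.hasDerivAt.norm_sq
  have hsq : 0 ≤ w r * Real.sinh r ^ (d - 1) * ‖deriv u r - hardyDrift d r • u r‖ ^ 2 := by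
    positivity
  have hcoth : cothR r ^ 2 = 1 + (Real.sinh r ^ 2)⁻¹ := by
    unfold cothR
    field_simp
    linear_combination Real.cosh_sq r
  rw [norm_sub_sq_real, inner_smul_right, real_inner_comm, norm_smul, mul_pow, Real.norm_eq_abs,
    sq_abs] at hsq
  refine hF.deriv.trans_le (sub_nonneg.mp (hsq.trans_eq ?_))
  rw [Upot_eq]
  simp only [Pi.mul_apply]
  set S := Real.sinh r ^ (d - 1)
  set I := inner ℝ (u r) (deriv u r)
  have hφ : hardyDrift d r = r⁻¹ / 2 - rho d * cothR r := by
    unfold hardyDrift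
    ring
  rw [hφ]
  simp only [div_eq_mul_inv, mul_inv, ← inv_pow] at hcoth ⊢
  linear_combination (-w r * S * ‖u r‖ ^ 2 * rho d ^ 2) * hcoth

/-- **Weighted Hardy–Poincaré inequality** (Lemma 5.2, inequality (5.2), radial form):
for a smooth nonnegative weight `w` on `(0,∞)` and every test function `u`,
`∫ w (|u′|² − ρ² |u|²) dμ_d − ρ ∫ coth(r) w′(r) |u|² dμ_d
  ≥ ∫ U w |u|² dμ_d − ∫ (w′(r)/(2r)) |u|² dμ_d`. -/
theorem weighted_hardy_poincare_inequality (d : ℕ) (hd : 2 ≤ d)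
    (w : ℝ → ℝ) (hw : ContDiffOn ℝ (⊤ : ℕ∞) w (Ioi (0 : ℝ)))
    (hw_nonneg : ∀ r ∈ Ioi (0 : ℝ), 0 ≤ w r)
    (u : ℝ → ℂ) (hu : IsTestFun u) :
    (∫ r in Ioi (0 : ℝ), Upot d r * w r * ‖u r‖ ^ 2 * Real.sinh r ^ (d - 1))
        - (∫ r in Ioi (0 : ℝ), (deriv w r / (2 * r)) * ‖u r‖ ^ 2 * Real.sinh r ^ (d - 1))
      ≤ (∫ r in Ioi (0 : ℝ),
            w r * (‖deriv u r‖ ^ 2 - rho d ^ 2 * ‖u r‖ ^ 2) * Real.sinh r ^ (d - 1))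
        - rho d * ∫ r in Ioi (0 : ℝ),
            cothR r * deriv w r * ‖u r‖ ^ 2 * Real.sinh r ^ (d - 1) := by
  have hcs : ContinuousOn (fun r => Real.sinh r ^ (d - 1)) (Ioi (0 : ℝ)) := by fun_prop
  have hwc : ContinuousOn w (Ioi (0 : ℝ)) := hw.continuousOn
  have hwd : ContinuousOn (deriv w) (Ioi (0 : ℝ)) :=
    hw.continuousOn_deriv_of_isOpen isOpen_Ioi (by simp)
  have hcoth : ContinuousOn cothR (Ioi (0 : ℝ)) := fun r hr =>
    (hasDerivAt_cothR (ne_of_gt hr)).continuousAt.continuousWithinAt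
  have hU : ContinuousOn (Upot d) (Ioi (0 : ℝ)) := by
    simp only [funext (Upot_eq d)]
    have h1 : ∀ r ∈ Ioi (0 : ℝ), r ^ 2 ≠ 0 := fun r hr => pow_ne_zero 2 (ne_of_gt hr)
    have h2 : ∀ r ∈ Ioi (0 : ℝ), Real.sinh r ^ 2 ≠ 0 := fun r hr =>
      pow_ne_zero 2 (Real.sinh_ne_zero.mpr (ne_of_gt hr))
    fun_prop (disch := assumption)
  have huc : Continuous u := hu.1.continuous
  have hduc : Continuous (deriv u) := hu.1.continuous_deriv (by simp)
  have hi1 := hu.integrableOn_mul_norm_sq_mul (f := fun r => Upot d r * w r) (hU.mul hwc) hcs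
  have hi2 := hu.integrableOn_mul_norm_sq_mul (f := fun r => deriv w r / (2 * r))
    (hwd.div (by fun_prop) fun r hr => mul_ne_zero two_ne_zero (ne_of_gt hr)) hcs
  have hi3 : IntegrableOn (fun r => w r * (‖deriv u r‖ ^ 2 - rho d ^ 2 * ‖u r‖ ^ 2) *
      Real.sinh r ^ (d - 1)) (Ioi (0 : ℝ)) := by
    refine hu.integrableOn_of_support_subset (by fun_prop) fun x hx => ?_
    by_contra h
    have h0 : u x = 0 := image_eq_zero_of_notMem_tsupport h
    have h1 : deriv u x = 0 := Function.notMem_support.mp fun h' => h (support_deriv_subset h')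
    simp [h0, h1] at hx
  have hi4 := (hu.integrableOn_mul_norm_sq_mul (f := fun r => cothR r * deriv w r)
    (hcoth.mul hwd) hcs).const_mul (rho d)
  obtain ⟨hi5, hzero⟩ := hu.integral_deriv_mul_norm_sq
    (g := fun r => w r * Real.sinh r ^ (d - 1) * hardyDrift d r)
    (((hw.of_le (by exact_mod_cast le_top)).mul (Real.contDiff_sinh.pow _).contDiffOn).mul
      (contDiffOn_hardyDrift d))
  have key := setIntegral_mono_on hi5 ((hi3.sub hi4).sub (hi1.sub hi2)) measurableSet_Ioi
    fun r hr => deriv_le_hardy_integrand (by omega) hr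
      ((hw.contDiffAt (Ioi_mem_nhds hr)).differentiableAt (by simp)) (hw_nonneg r hr)
      ((hu.1.differentiable (by simp)) r)
  rw [hzero, integral_sub' (hi3.sub hi4) (hi1.sub hi2), integral_sub' hi3 hi4,
    integral_sub' hi1 hi2, integral_const_mul, sub_nonneg] at key
  exact key
end

section
/- Threshold Hardy–Poincaré inequality in dimensions d ≥ 3 (radial form; Step 1.a of the proof of Proposition 8.9): for every integer d ≥ 3 and every test function v, (1/4) ∫ r^{−2} |v|² dμ_d ≤ ∫ (|v′|² − ρ² |v|²) dμ_d. -/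
open MeasureTheory Set

/-- The logarithmic derivative of `√r * sinh(r)^(-ρ)`. -/
noncomputable def hardyWeight (ρ r : ℝ) : ℝ := (2 * r)⁻¹ - ρ * (Real.cosh r / Real.sinh r)

theorem hasDerivAt_hardyWeight (ρ : ℝ) {r : ℝ} (hr : 0 < r) :
    HasDerivAt (hardyWeight ρ) (-(2 * r ^ 2)⁻¹ + ρ / Real.sinh r ^ 2) r := by
  have hs : Real.sinh r ≠ 0 := (Real.sinh_pos_iff.2 hr).ne'
  have h := (((hasDerivAt_id r).const_mul 2).inv (by simpa using hr.ne')).sub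
    (((Real.hasDerivAt_cosh r).div (Real.hasDerivAt_sinh r) hs).const_mul ρ)
  refine h.congr_deriv ?_
  have hc := Real.cosh_sq r
  simp only [id]
  field_simp
  linear_combination (2 * ρ * r ^ 2) * hc

/-- A function continuous on `(0, ∞)` vanishing off a compact subset of `(0, ∞)` is integrable. -/
theorem integrableOn_Ioi_of_eq_zero_off_compact {f : ℝ → ℝ} {K : Set ℝ} (hK : IsCompact K)
    (hK0 : K ⊆ Ioi 0) (hf : ContinuousOn f (Ioi 0)) (h0 : ∀ r ∉ K, f r = 0) :
    IntegrableOn f (Ioi 0) :=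
  ((hf.mono hK0).integrableOn_compact hK).of_forall_sdiff_eq_zero measurableSet_Ioi
    fun r hr => h0 r hr.2

/-- The derivative of `hardyWeight ρ * sinh ^ (m + 2) * ‖v‖ ^ 2`. -/
noncomputable def hardyFluxDeriv (ρ : ℝ) (m : ℕ) (v : ℝ → ℂ) (r : ℝ) : ℝ :=
  ((-(2 * r ^ 2)⁻¹ + ρ / Real.sinh r ^ 2) * Real.sinh r ^ (m + 2)
    + hardyWeight ρ r * ((m + 2 : ℝ) * Real.sinh r ^ (m + 1) * Real.cosh r)) * ‖v r‖ ^ 2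
  + hardyWeight ρ r * Real.sinh r ^ (m + 2) * (2 * inner ℝ (v r) (deriv v r))

theorem hasDerivAt_hardyFlux (ρ : ℝ) (m : ℕ) {v : ℝ → ℂ} {r : ℝ} (hr : 0 < r)
    (hv : DifferentiableAt ℝ v r) :
    HasDerivAt (fun r => hardyWeight ρ r * Real.sinh r ^ (m + 2) * ‖v r‖ ^ 2)
      (hardyFluxDeriv ρ m v r) r := by
  have h := ((hasDerivAt_hardyWeight ρ hr).mul
    ((Real.hasDerivAt_sinh r).pow (m + 2))).mul hv.hasDerivAt.norm_sq
  refine h.congr_deriv ?_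
  simp [hardyFluxDeriv]

theorem hardyFluxDeriv_le {m : ℕ} {ρ : ℝ} (hρ : ρ = (m + 2) / 2) (v : ℝ → ℂ) {r : ℝ}
    (hr : 0 < r) :
    hardyFluxDeriv ρ m v r ≤
      (‖deriv v r‖ ^ 2 - ρ ^ 2 * ‖v r‖ ^ 2) * Real.sinh r ^ (m + 2)
        - 1 / 4 * ((r ^ 2)⁻¹ * ‖v r‖ ^ 2 * Real.sinh r ^ (m + 2)) := by
  have hs : 0 < Real.sinh r := Real.sinh_pos_iff.2 hr
  have hm : (m : ℝ) = 2 * ρ - 2 := by rw [hρ]; ring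
  have hρ1 : 1 ≤ ρ := by rw [hρ]; linarith [(Nat.cast_nonneg m : (0 : ℝ) ≤ m)]
  have hsq : 0 ≤ ‖deriv v r - hardyWeight ρ r • v r‖ ^ 2 * Real.sinh r ^ (m + 2) := by positivity
  have hrem : 0 ≤ ρ * (ρ - 1) * ‖v r‖ ^ 2 * Real.sinh r ^ m :=
    mul_nonneg (mul_nonneg (mul_nonneg (by linarith) (by linarith)) (sq_nonneg _)) (by positivity)
  rw [norm_sub_sq_real, inner_smul_right, norm_smul, mul_pow, Real.norm_eq_abs, sq_abs,
    real_inner_comm] at hsq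
  refine sub_nonneg.1 ((add_nonneg hsq hrem).trans_eq ?_)
  rw [hardyFluxDeriv, hm]
  generalize inner ℝ (v r) (deriv v r) = p
  have hc := Real.cosh_sq r
  simp only [hardyWeight, pow_add]
  field_simp
  ring_nf
  simp only [hc]
  ring

theorem integral_hardyFluxDeriv (ρ : ℝ) (m : ℕ) {v : ℝ → ℂ} (hv : IsTestFun v)
    (hint : IntegrableOn (hardyFluxDeriv ρ m v) (Ioi 0)) :
    ∫ r in Ioi (0 : ℝ), hardyFluxDeriv ρ m v r = 0 := by
  obtain ⟨hsm, hcs, hsub⟩ := hv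
  have h0 : v =ᶠ[nhds 0] 0 :=
    notMem_tsupport_iff_eventuallyEq.1 fun h => lt_irrefl (0 : ℝ) (hsub h)
  have hinf : v =ᶠ[Filter.atTop] 0 :=
    Filter.EventuallyEq.filter_mono (hasCompactSupport_iff_eventuallyEq.1 hcs)
      (atTop_le_cocompact.trans_eq Filter.coclosedCompact_eq_cocompact.symm)
  have h := integral_Ioi_of_hasDerivAt_of_tendsto (a := 0) (m := 0)
    (f := fun r => hardyWeight ρ r * Real.sinh r ^ (m + 2) * ‖v r‖ ^ 2)
    (ContinuousAt.continuousWithinAt <| (continuousAt_const (y := (0 : ℝ))).congr <| by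
      filter_upwards [h0] with r hr
      simp [hr])
    (fun r hr => hasDerivAt_hardyFlux ρ m hr (hsm.differentiable (by simp) r)) hint
    (tendsto_const_nhds.congr' <| by
      filter_upwards [hinf] with r hr
      simp [hr])
  simpa using h

/-- **Threshold Hardy–Poincaré inequality in dimensions `d ≥ 3`** (radial form;
Step 1.a of the proof of Proposition 8.9): for every integer `d ≥ 3` and every
test function `v`, `(1/4) ∫ r⁻² |v|² dμ_d ≤ ∫ (|v′|² − ρ² |v|²) dμ_d`,
where `ρ = (d−1)/2` and `dμ_d = sinh(r)^{d−1} dr`. -/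
theorem threshold_hardy_poincare (d : ℕ) (hd : 3 ≤ d)
    (v : ℝ → ℂ) (hv : IsTestFun v) :
    (1 / 4) * ∫ r in Ioi (0 : ℝ), (r ^ 2)⁻¹ * ‖v r‖ ^ 2 * Real.sinh r ^ (d - 1) ≤
      ∫ r in Ioi (0 : ℝ),
        (‖deriv v r‖ ^ 2 - (((d : ℝ) - 1) / 2) ^ 2 * ‖v r‖ ^ 2) * Real.sinh r ^ (d - 1) := by
  obtain ⟨m, rfl⟩ := Nat.exists_eq_add_of_le' hd
  set ρ : ℝ := (((m + 3 : ℕ) : ℝ) - 1) / 2 with hρdef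
  have hρ : ρ = (m + 2) / 2 := by rw [hρdef]; push_cast; ring
  have hexp : m + 3 - 1 = m + 2 := rfl
  rw [hexp]
  have hcv : Continuous v := hv.1.continuous
  have hcd : Continuous (deriv v) := hv.1.continuous_deriv (by simp)
  have hv0 : ∀ r ∉ tsupport v, v r = 0 := fun r hr => image_eq_zero_of_notMem_tsupport hr
  have hd0 : ∀ r ∉ tsupport v, deriv v r = 0 := fun r hr =>
    Function.notMem_support.1 fun h => hr (support_deriv_subset h)
  have hr0 : ∀ r ∈ Ioi (0 : ℝ), r ^ 2 ≠ 0 := fun r hr => pow_ne_zero 2 (ne_of_gt hr)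
  have hs0 : ∀ r ∈ Ioi (0 : ℝ), Real.sinh r ^ 2 ≠ 0 := fun r hr =>
    pow_ne_zero 2 (Real.sinh_pos_iff.2 hr).ne'
  have hcw : ContinuousOn (hardyWeight ρ) (Ioi 0) := fun r hr =>
    (hasDerivAt_hardyWeight ρ hr).continuousAt.continuousWithinAt
  have hcr : ContinuousOn (fun r : ℝ => (r ^ 2)⁻¹) (Ioi 0) :=
    (continuous_pow 2).continuousOn.inv₀ hr0
  have hF : IntegrableOn (hardyFluxDeriv ρ m v) (Ioi 0) := by
    refine integrableOn_Ioi_of_eq_zero_off_compact hv.2.1 hv.2.2 ?_ fun r hr => by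
      simp [hardyFluxDeriv, hv0 r hr]
    have hcs : ContinuousOn (fun r : ℝ => ρ / Real.sinh r ^ 2) (Ioi 0) :=
      continuousOn_const.div (Real.continuous_sinh.pow 2).continuousOn hs0
    have hcr' : ContinuousOn (fun r : ℝ => (2 * r ^ 2)⁻¹) (Ioi 0) :=
      ContinuousOn.inv₀ (by fun_prop) fun r hr => mul_ne_zero two_ne_zero (hr0 r hr)
    unfold hardyFluxDeriv
    fun_prop
  have hL : IntegrableOn (fun r => (r ^ 2)⁻¹ * ‖v r‖ ^ 2 * Real.sinh r ^ (m + 2)) (Ioi 0) :=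
    integrableOn_Ioi_of_eq_zero_off_compact hv.2.1 hv.2.2 (by fun_prop) fun r hr => by
      simp [hv0 r hr]
  have hR : IntegrableOn (fun r => (‖deriv v r‖ ^ 2 - ρ ^ 2 * ‖v r‖ ^ 2) *
      Real.sinh r ^ (m + 2)) (Ioi 0) :=
    integrableOn_Ioi_of_eq_zero_off_compact hv.2.1 hv.2.2 (by fun_prop) fun r hr => by
      simp [hv0 r hr, hd0 r hr]
  have hmono := setIntegral_mono_on hF (hR.sub (hL.const_mul (1 / 4))) measurableSet_Ioi
    fun r hr => hardyFluxDeriv_le hρ v hr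
  rw [integral_hardyFluxDeriv ρ m hv hF] at hmono
  simp only [Pi.sub_apply] at hmono
  rw [integral_sub hR (hL.const_mul (1 / 4)), integral_const_mul] at hmono
  linarith
end

section
/- Two-dimensional threshold identity and coercivity (radial form of the estimate used in Step 1.b of the proof of Proposition 8.9): there is a universal constant c₀ > 0 such that for every test function v, ∫ (|v′|² − (1/4)|v|²) sinh(r) dr = ∫ |v′ + (1/2)(coth(r) − r^{−1}) v|² sinh(r) dr + (1/4) ∫ (r^{−2} − sinh(r)^{−2}) |v|² sinh(r) dr, and consequently ∫ (|v′|² − (1/4)|v|²) sinh(r) dr ≥ c₀ ∫ (1+r²)^{−1} |v|² sinh(r) dr. -/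
open MeasureTheory Set

/-- The third order Taylor lower bound for the hyperbolic sine. -/
theorem add_pow_three_div_six_le_sinh {r : ℝ} (hr : 0 ≤ r) :
    r + r ^ 3 / 6 ≤ Real.sinh r := by
  have h := sum_le_hasSum (Finset.range 2) (fun n _ => by positivity) (Real.hasSum_sinh r)
  norm_num [Finset.sum_range_succ, Nat.factorial] at h
  linarith

theorem inv_sq_sub_inv_sinh_sq_ge {r : ℝ} (hr : 0 < r) :
    (1 / 3) * (1 + r ^ 2)⁻¹ ≤ (r ^ 2)⁻¹ - (Real.sinh r ^ 2)⁻¹ := by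
  have h := add_pow_three_div_six_le_sinh hr.le
  have hsq : r ^ 2 * (1 + r ^ 2 / 3) ≤ Real.sinh r ^ 2 :=
    calc r ^ 2 * (1 + r ^ 2 / 3) ≤ (r + r ^ 3 / 6) ^ 2 := by nlinarith [sq_nonneg (r ^ 3)]
      _ ≤ Real.sinh r ^ 2 := by gcongr
  have hinv : (Real.sinh r ^ 2)⁻¹ ≤ (r ^ 2 * (1 + r ^ 2 / 3))⁻¹ := by gcongr
  have hsub : (r ^ 2)⁻¹ - (r ^ 2 * (1 + r ^ 2 / 3))⁻¹ = (3 + r ^ 2)⁻¹ := by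
    field_simp
    ring
  have hle : (1 / 3) * (1 + r ^ 2)⁻¹ ≤ (3 + r ^ 2)⁻¹ := by
    rw [one_div, ← mul_inv]
    gcongr
    nlinarith [sq_nonneg r]
  linarith

/-- A function that is continuous on `(0, ∞)` and vanishes off the support of a test function
is integrable. -/
theorem IsTestFun.integrable {v : ℝ → ℂ} (hv : IsTestFun v) {g : ℝ → ℝ}
    (hg : ContinuousOn g (Ioi 0)) (hg0 : ∀ r ∉ tsupport v, g r = 0) : Integrable g := by
  rw [← integrableOn_iff_integrable_of_support_subset (s := tsupport v)
    fun r hr => by_contra fun h => hr (hg0 r h)]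
  exact (hg.mono hv.2.2).integrableOn_compact hv.2.1

theorem hasDerivAt_cosh_sub_sinh_div {r : ℝ} (hr : r ≠ 0) :
    HasDerivAt (fun r => (Real.cosh r - Real.sinh r * r⁻¹) / 2)
      ((Real.sinh r - Real.cosh r * r⁻¹ + Real.sinh r * (r ^ 2)⁻¹) / 2) r := by
  refine (((Real.hasDerivAt_cosh r).sub
    ((Real.hasDerivAt_sinh r).mul (hasDerivAt_inv hr))).div_const 2).congr_deriv ?_
  ring

/-- Integration by parts for `‖v‖ ^ 2` against the weight `(cosh r - sinh r / r) / 2`. -/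
theorem IsTestFun.integral_weight_eq_zero {v : ℝ → ℂ} (hv : IsTestFun v) :
    let D : ℝ → ℝ := fun r =>
      (Real.sinh r - Real.cosh r * r⁻¹ + Real.sinh r * (r ^ 2)⁻¹) / 2 * ‖v r‖ ^ 2 +
        (Real.cosh r - Real.sinh r * r⁻¹) / 2 * (2 * inner ℝ (v r) (deriv v r))
    Integrable D ∧ ∫ r in Ioi (0 : ℝ), D r = 0 := by
  intro D
  have hvc : Continuous v := hv.1.continuous
  have hdc : Continuous (deriv v) := hv.1.continuous_deriv (by simp)
  have hv0 : ∀ r ∉ tsupport v, v r = 0 := fun r hr => image_eq_zero_of_notMem_tsupport hr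
  have hne : ∀ r ∈ Ioi (0 : ℝ), r ≠ 0 := fun r hr => ne_of_gt hr
  have hne2 : ∀ r ∈ Ioi (0 : ℝ), r ^ 2 ≠ 0 := fun r hr => pow_ne_zero 2 (hne r hr)
  have hsinh := Real.continuous_sinh
  have hcosh := Real.continuous_cosh
  have hD0 : ∀ r ∉ tsupport v, D r = 0 := fun r hr => by simp [D, hv0 r hr]
  have hD : Integrable D := hv.integrable (by fun_prop (disch := assumption)) hD0
  refine ⟨hD, ?_⟩
  rw [setIntegral_eq_integral_of_forall_compl_eq_zero
    fun r hr => hD0 r fun h => hr (hv.2.2 h)]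
  refine integral_eq_zero_of_hasDerivAt_of_integrable
    (f := fun r => (Real.cosh r - Real.sinh r * r⁻¹) / 2 * ‖v r‖ ^ 2) (fun r => ?_) hD
    (hv.integrable (by fun_prop (disch := assumption)) fun r hr => by simp [hv0 r hr])
  by_cases hr : r ∈ tsupport v
  · exact (hasDerivAt_cosh_sub_sinh_div (hne r (hv.2.2 hr))).mul
      ((hv.1.differentiable (by simp)) r).hasDerivAt.norm_sq
  · rw [hD0 r hr]
    refine (hasDerivAt_const r (0 : ℝ)).congr_of_eventuallyEq ?_
    filter_upwards [notMem_tsupport_iff_eventuallyEq.mp hr] with x hx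
    simp [hx]

/-- The pointwise form of the threshold identity. -/
theorem threshold_pointwise {r : ℝ} (hr : 0 < r) (z w : ℂ) :
    ‖w + (((1 / 2) * (cothR r - r⁻¹) : ℝ) : ℂ) * z‖ ^ 2 * Real.sinh r +
        (1 / 4) * (((r ^ 2)⁻¹ - (Real.sinh r ^ 2)⁻¹) * ‖z‖ ^ 2 * Real.sinh r) =
      (‖w‖ ^ 2 - (1 / 4) * ‖z‖ ^ 2) * Real.sinh r +
        ((Real.sinh r - Real.cosh r * r⁻¹ + Real.sinh r * (r ^ 2)⁻¹) / 2 * ‖z‖ ^ 2 +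
          (Real.cosh r - Real.sinh r * r⁻¹) / 2 * (2 * inner ℝ z w)) := by
  have hs : Real.sinh r ≠ 0 := (Real.sinh_pos_iff.mpr hr).ne'
  rw [← Complex.real_smul, norm_add_sq_real, norm_smul, mul_pow, Real.norm_eq_abs, sq_abs,
    inner_smul_right, real_inner_comm, cothR]
  have hc := Real.cosh_sq r
  field_simp
  linear_combination (4 * r ^ 2 * ‖z‖ ^ 2) * hc

/-- **Two-dimensional threshold identity and coercivity** (radial form of the
estimate used in Step 1.b of the proof of Proposition 8.9): there is a universal
constant `c₀ > 0` such that for every test function `v`,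
`∫ (|v′|² − (1/4)|v|²) sinh(r) dr
  = ∫ |v′ + (1/2)(coth(r) − r⁻¹) v|² sinh(r) dr
    + (1/4) ∫ (r⁻² − sinh(r)⁻²) |v|² sinh(r) dr`,
and consequently
`∫ (|v′|² − (1/4)|v|²) sinh(r) dr ≥ c₀ ∫ (1+r²)⁻¹ |v|² sinh(r) dr`. -/
theorem two_dim_threshold_identity_and_coercivity :
    ∃ c₀ > (0 : ℝ), ∀ v : ℝ → ℂ, IsTestFun v →
      ((∫ r in Ioi (0 : ℝ), (‖deriv v r‖ ^ 2 - (1 / 4) * ‖v r‖ ^ 2) * Real.sinh r)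
          = (∫ r in Ioi (0 : ℝ),
              ‖deriv v r + (((1 / 2) * (cothR r - r⁻¹) : ℝ) : ℂ) * v r‖ ^ 2 * Real.sinh r)
            + (1 / 4) * ∫ r in Ioi (0 : ℝ),
                ((r ^ 2)⁻¹ - (Real.sinh r ^ 2)⁻¹) * ‖v r‖ ^ 2 * Real.sinh r)
      ∧ c₀ * ∫ r in Ioi (0 : ℝ), (1 + r ^ 2)⁻¹ * ‖v r‖ ^ 2 * Real.sinh r ≤
          ∫ r in Ioi (0 : ℝ), (‖deriv v r‖ ^ 2 - (1 / 4) * ‖v r‖ ^ 2) * Real.sinh r := by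
  refine ⟨1 / 12, by norm_num, fun v hv => ?_⟩
  have hvc : Continuous v := hv.1.continuous
  have hdc : Continuous (deriv v) := hv.1.continuous_deriv (by simp)
  have hv0 : ∀ r ∉ tsupport v, v r = 0 := fun r hr => image_eq_zero_of_notMem_tsupport hr
  have hd0 : ∀ r ∉ tsupport v, deriv v r = 0 := fun r hr =>
    by_contra fun h => hr (support_deriv_subset h)
  have hne : ∀ r ∈ Ioi (0 : ℝ), r ≠ 0 := fun r hr => ne_of_gt hr
  have hne2 : ∀ r ∈ Ioi (0 : ℝ), r ^ 2 ≠ 0 := fun r hr => pow_ne_zero 2 (hne r hr)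
  have hs : ∀ r ∈ Ioi (0 : ℝ), Real.sinh r ≠ 0 := fun r hr => (Real.sinh_pos_iff.mpr hr).ne'
  have hs2 : ∀ r ∈ Ioi (0 : ℝ), Real.sinh r ^ 2 ≠ 0 := fun r hr => pow_ne_zero 2 (hs r hr)
  have hsinh := Real.continuous_sinh
  have hcosh := Real.continuous_cosh
  have hcoth : ContinuousOn cothR (Ioi 0) := hcosh.continuousOn.div hsinh.continuousOn hs
  have hL : Integrable fun r => (‖deriv v r‖ ^ 2 - (1 / 4) * ‖v r‖ ^ 2) * Real.sinh r :=
    hv.integrable (by fun_prop) fun r hr => by simp [hv0 r hr, hd0 r hr]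
  have hS : Integrable fun r =>
      ‖deriv v r + (((1 / 2) * (cothR r - r⁻¹) : ℝ) : ℂ) * v r‖ ^ 2 * Real.sinh r :=
    hv.integrable (by fun_prop (disch := assumption)) fun r hr => by simp [hv0 r hr, hd0 r hr]
  have hP : Integrable fun r =>
      ((r ^ 2)⁻¹ - (Real.sinh r ^ 2)⁻¹) * ‖v r‖ ^ 2 * Real.sinh r :=
    hv.integrable (by fun_prop (disch := assumption)) fun r hr => by simp [hv0 r hr]
  have hpos : ∀ r ∈ Ioi (0 : ℝ), 1 + r ^ 2 ≠ 0 := fun r _ => by positivity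
  have hW : Integrable fun r => (1 + r ^ 2)⁻¹ * ‖v r‖ ^ 2 * Real.sinh r :=
    hv.integrable (by fun_prop (disch := assumption)) fun r hr => by simp [hv0 r hr]
  obtain ⟨hD, hD0⟩ := hv.integral_weight_eq_zero
  have hid := setIntegral_congr_fun (μ := volume) measurableSet_Ioi
    fun r (hr : r ∈ Ioi (0 : ℝ)) => threshold_pointwise hr (v r) (deriv v r)
  rw [integral_add hS.integrableOn (hP.const_mul _).integrableOn,
    integral_add hL.integrableOn hD.integrableOn, hD0, add_zero, integral_const_mul] at hid
  refine ⟨hid.symm, ?_⟩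
  have hS0 : 0 ≤ ∫ r in Ioi (0 : ℝ),
      ‖deriv v r + (((1 / 2) * (cothR r - r⁻¹) : ℝ) : ℂ) * v r‖ ^ 2 * Real.sinh r :=
    setIntegral_nonneg measurableSet_Ioi fun r hr =>
      mul_nonneg (sq_nonneg _) (Real.sinh_pos_iff.mpr hr).le
  have hWP := setIntegral_mono_on (hW.const_mul (1 / 3)).integrableOn hP.integrableOn
    measurableSet_Ioi fun r hr => by
      have := (Real.sinh_pos_iff.mpr hr).le
      rw [← mul_assoc, ← mul_assoc]
      gcongr
      exact inv_sq_sub_inv_sinh_sq_ge hr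
  rw [integral_const_mul] at hWP
  linarith
end

section
/- Charge identity (Lemma 8.4, radial form): let γ : (0,∞) → ℝ be smooth and κ ∈ ℝ. For every test function v, Re ∫ i ((ρ²+κ²) v + Δ_rad v) · conj(v) · γ dμ_d = Im ∫ γ′ v′ conj(v) dμ_d = κ ∫ γ′ |v|² dμ_d + Im ∫ γ′ (v′ + (ρ coth(r) − iκ) v) conj(v) dμ_d. -/
open MeasureTheory Set

/-- The radial part of the Laplace–Beltrami operator of hyperbolic space:
`Δ_rad f = f″ + (d−1) coth(r) f′`. -/
noncomputable def DradC (d : ℕ) (v : ℝ → ℂ) (r : ℝ) : ℂ :=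
  deriv (deriv v) r + ((((d : ℝ) - 1) * cothR r : ℝ) : ℂ) * deriv v r

/-- A function continuous on `(0, ∞)` which vanishes wherever the test function `v` does is
integrable on `(0, ∞)`. -/
lemma IsTestFun.integrableOn_Ioi {v : ℝ → ℂ} (hv : IsTestFun v) {f : ℝ → ℂ}
    (hf : ContinuousOn f (Ioi (0 : ℝ))) (h0 : ∀ r, v r = 0 → f r = 0) :
    IntegrableOn f (Ioi (0 : ℝ)) := by
  obtain ⟨-, hc, hs⟩ := hv
  have hK : IntegrableOn f (tsupport v) := (hf.mono hs).integrableOn_compact hc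
  have hsub : Function.support f ⊆ tsupport v := fun r hr =>
    subset_tsupport v fun h => hr (h0 r h)
  exact ((integrableOn_iff_integrable_of_support_subset hsub).1 hK).integrableOn

/-- The derivative of a function which is `C¹` on `(0, ∞)` and vanishes wherever the test
function `v` does integrates to zero over `(0, ∞)`. -/
lemma IsTestFun.integrableOn_deriv_and_integral_deriv_eq_zero {v : ℝ → ℂ} (hv : IsTestFun v)
    {F : ℝ → ℂ} (hF : ContDiffOn ℝ 1 F (Ioi (0 : ℝ))) (h0 : ∀ r, v r = 0 → F r = 0) :
    IntegrableOn (deriv F) (Ioi (0 : ℝ)) ∧ ∫ r in Ioi (0 : ℝ), deriv F r = 0 := by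
  obtain ⟨-, hc, hs⟩ := hv
  have hsub : Function.support F ⊆ Function.support v := fun r hr h => hr (h0 r h)
  have hcF : HasCompactSupport F := hc.mono hsub
  have hF' : ContDiff ℝ 1 F := contMDiff_iff_contDiff.1 <| contMDiff_of_tsupport fun r hr =>
    (hF.contDiffAt (Ioi_mem_nhds (hs (closure_mono hsub hr)))).contMDiffAt
  refine ⟨((hF'.continuous_deriv le_rfl).integrable_of_hasCompactSupport
    hcF.deriv).integrableOn, ?_⟩
  have hF0 : F 0 = 0 := h0 0 (image_eq_zero_of_notMem_tsupport fun h => lt_irrefl (0 : ℝ) (hs h))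
  rw [hcF.integral_Ioi_deriv_eq hF', hF0, neg_zero]

/-- The derivative of the flux `γ v′ conj(v) sinh^{d-1}` on `(0, ∞)`. -/
lemma hasDerivAt_flux {d : ℕ} (hd : 2 ≤ d) {γ : ℝ → ℝ} {v : ℝ → ℂ} {r : ℝ} (hr : 0 < r)
    (hγ : DifferentiableAt ℝ γ r) (hv : DifferentiableAt ℝ v r)
    (hv' : DifferentiableAt ℝ (deriv v) r) :
    HasDerivAt (fun r => ((γ r * Real.sinh r ^ (d - 1) : ℝ) : ℂ)
        * (deriv v r * (starRingEnd ℂ) (v r)))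
      (((deriv γ r : ℝ) : ℂ) * deriv v r * (starRingEnd ℂ) (v r)
          * ((Real.sinh r ^ (d - 1) : ℝ) : ℂ)
        + DradC d v r * (starRingEnd ℂ) (v r) * ((γ r * Real.sinh r ^ (d - 1) : ℝ) : ℂ)
        + ((γ r * Real.sinh r ^ (d - 1) * ‖deriv v r‖ ^ 2 : ℝ) : ℂ)) r := by
  have hsinh : Real.sinh r ≠ 0 := (Real.sinh_pos_iff.2 hr).ne'
  have hw := (hγ.hasDerivAt.mul ((Real.hasDerivAt_sinh r).pow (d - 1))).ofReal_comp
  have hstar : HasDerivAt (fun r => (starRingEnd ℂ) (v r)) ((starRingEnd ℂ) (deriv v r)) r :=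
    hv.hasDerivAt.star
  refine (hw.mul (hv'.hasDerivAt.mul hstar)).congr_deriv ?_
  obtain ⟨n, rfl⟩ : ∃ n, d = n + 2 := ⟨d - 2, by lia⟩
  have hcoth : Real.sinh r ^ (n + 1) * cothR r = Real.sinh r ^ n * Real.cosh r := by
    rw [cothR, pow_succ]
    field_simp
  have hcoth' : (Real.sinh r : ℂ) ^ (n + 1) * (cothR r : ℂ)
      = (Real.sinh r : ℂ) ^ n * (Real.cosh r : ℂ) := by exact_mod_cast hcoth
  have hnorm : ((‖deriv v r‖ : ℝ) : ℂ) ^ 2 = deriv v r * (starRingEnd ℂ) (deriv v r) :=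
    (Complex.mul_conj' _).symm
  simp only [DradC, Pi.mul_apply, Pi.pow_apply, show n + 2 - 1 = n + 1 from rfl,
    add_tsub_cancel_right]
  push_cast [-Complex.ofReal_sinh, -Complex.ofReal_cosh]
  rw [hnorm]
  linear_combination -(γ r : ℂ) * (n + 1) * deriv v r * (starRingEnd ℂ) (v r) * hcoth'

/-- **Charge identity** (Lemma 8.4, radial form): for a smooth weight `γ` on
`(0,∞)`, `κ ∈ ℝ`, and every test function `v`,
`Re ∫ i ((ρ²+κ²) v + Δ_rad v) conj(v) γ dμ_d = Im ∫ γ′ v′ conj(v) dμ_d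
  = κ ∫ γ′ |v|² dμ_d + Im ∫ γ′ (v′ + (ρ coth(r) − iκ) v) conj(v) dμ_d`. -/
theorem charge_identity (d : ℕ) (hd : 2 ≤ d)
    (γ : ℝ → ℝ) (hγ : ContDiffOn ℝ (⊤ : ℕ∞) γ (Ioi (0 : ℝ))) (κ : ℝ)
    (v : ℝ → ℂ) (hv : IsTestFun v) :
    ((∫ r in Ioi (0 : ℝ),
        Complex.I * (((rho d ^ 2 + κ ^ 2 : ℝ) : ℂ) * v r + DradC d v r)
          * (starRingEnd ℂ) (v r) * ((γ r * Real.sinh r ^ (d - 1) : ℝ) : ℂ)).re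
      = (∫ r in Ioi (0 : ℝ),
          ((deriv γ r : ℝ) : ℂ) * deriv v r * (starRingEnd ℂ) (v r)
            * ((Real.sinh r ^ (d - 1) : ℝ) : ℂ)).im)
    ∧ ((∫ r in Ioi (0 : ℝ),
          ((deriv γ r : ℝ) : ℂ) * deriv v r * (starRingEnd ℂ) (v r)
            * ((Real.sinh r ^ (d - 1) : ℝ) : ℂ)).im
      = κ * (∫ r in Ioi (0 : ℝ), deriv γ r * ‖v r‖ ^ 2 * Real.sinh r ^ (d - 1))
        + (∫ r in Ioi (0 : ℝ),
            ((deriv γ r : ℝ) : ℂ)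
              * (deriv v r + (((rho d * cothR r : ℝ) : ℂ) - Complex.I * (κ : ℂ)) * v r)
              * (starRingEnd ℂ) (v r) * ((Real.sinh r ^ (d - 1) : ℝ) : ℂ)).im) := by
  have hv₁ : ContDiff ℝ (⊤ : ℕ∞) (deriv v) := (contDiff_infty_iff_deriv.1 hv.1).2
  have hv₂ : Continuous (deriv (deriv v)) := (contDiff_infty_iff_deriv.1 hv₁).2.continuous
  have hconj : ContDiff ℝ (⊤ : ℕ∞) fun r => (starRingEnd ℂ) (v r) :=
    Complex.conjCLE.contDiff.comp hv.1
  have hvc : Continuous v := hv.1.continuous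
  have hv₁c : Continuous (deriv v) := hv₁.continuous
  have hconjc := hconj.continuous
  have hγc : ContinuousOn (fun r => (γ r : ℂ)) (Ioi 0) :=
    Complex.continuous_ofReal.comp_continuousOn hγ.continuousOn
  have hγ₁ : ContinuousOn (deriv γ) (Ioi 0) :=
    hγ.continuousOn_deriv_of_isOpen isOpen_Ioi (by norm_cast)
  have hγ₁c : ContinuousOn (fun r => ((deriv γ r : ℝ) : ℂ)) (Ioi 0) :=
    Complex.continuous_ofReal.comp_continuousOn hγ₁
  have hcoth : ContinuousOn cothR (Ioi 0) :=
    Real.continuous_cosh.continuousOn.div Real.continuous_sinh.continuousOn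
      fun r hr => (Real.sinh_pos_iff.2 hr).ne'
  have hcothc : ContinuousOn (fun r => (cothR r : ℂ)) (Ioi 0) :=
    Complex.continuous_ofReal.comp_continuousOn hcoth
  have hsc : Continuous fun r : ℝ => (Real.sinh r : ℂ) :=
    Complex.continuous_ofReal.comp Real.continuous_sinh
  have hI₁ : IntegrableOn (fun r => Complex.I
      * (((rho d ^ 2 + κ ^ 2 : ℝ) : ℂ) * v r + DradC d v r)
      * (starRingEnd ℂ) (v r) * ((γ r * Real.sinh r ^ (d - 1) : ℝ) : ℂ)) (Ioi 0) := by
    refine hv.integrableOn_Ioi ?_ fun r hr => by simp [hr]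
    simp only [DradC, Complex.ofReal_mul, Complex.ofReal_pow]
    fun_prop
  have hI₂ : IntegrableOn (fun r => ((deriv γ r : ℝ) : ℂ) * deriv v r * (starRingEnd ℂ) (v r)
      * ((Real.sinh r ^ (d - 1) : ℝ) : ℂ)) (Ioi 0) := by
    refine hv.integrableOn_Ioi ?_ fun r hr => by simp [hr]
    simp only [Complex.ofReal_pow]
    fun_prop
  have hI₃ : IntegrableOn (fun r => ((deriv γ r : ℝ) : ℂ)
      * (deriv v r + (((rho d * cothR r : ℝ) : ℂ) - Complex.I * (κ : ℂ)) * v r)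
      * (starRingEnd ℂ) (v r) * ((Real.sinh r ^ (d - 1) : ℝ) : ℂ)) (Ioi 0) := by
    refine hv.integrableOn_Ioi ?_ fun r hr => by simp [hr]
    simp only [Complex.ofReal_mul, Complex.ofReal_pow]
    fun_prop
  have hI₄ : IntegrableOn (fun r => ((deriv γ r * ‖v r‖ ^ 2 * Real.sinh r ^ (d - 1) : ℝ) : ℂ))
      (Ioi 0) := by
    refine hv.integrableOn_Ioi ?_ fun r hr => by simp [hr]
    simp only [Complex.ofReal_mul, Complex.ofReal_pow]
    fun_prop
  obtain ⟨hIF, hF⟩ := hv.integrableOn_deriv_and_integral_deriv_eq_zero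
    (F := fun r => ((γ r * Real.sinh r ^ (d - 1) : ℝ) : ℂ)
      * (deriv v r * (starRingEnd ℂ) (v r)))
    ((Complex.ofRealCLM.contDiff.comp_contDiffOn ((hγ.of_le (by norm_cast)).mul
      (Real.contDiff_sinh.pow (d - 1)).contDiffOn)).mul
      ((hv₁.mul hconj).of_le (by norm_cast)).contDiffOn)
    fun r hr => by simp [hr]
  constructor
  · have him : ∫ r in Ioi (0 : ℝ), (deriv (fun r => ((γ r * Real.sinh r ^ (d - 1) : ℝ) : ℂ)
        * (deriv v r * (starRingEnd ℂ) (v r))) r).im = 0 := by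
      have h := integral_im hIF
      rw [hF] at h
      simpa using h
    have h₁ := integral_re hI₁
    have h₂ := integral_im hI₂
    simp only [RCLike.re_to_complex, RCLike.im_to_complex] at h₁ h₂
    have hI₂' := hI₂.im
    have hIF' := hIF.im
    simp only [RCLike.im_to_complex] at hI₂' hIF'
    have hsub := integral_sub hI₂' hIF'
    rw [him, sub_zero] at hsub
    rw [← h₁, ← h₂, ← hsub]
    refine setIntegral_congr_fun measurableSet_Ioi fun r hr => ?_
    have hd₁ := hasDerivAt_flux hd hr
      ((hγ.differentiableOn (by simp)).differentiableAt (Ioi_mem_nhds hr))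
      (hv.1.differentiable (by simp) r) (hv₁.differentiable (by simp) r)
    rw [hd₁.deriv]
    simp only [Complex.add_im, Complex.add_re, Complex.mul_re, Complex.mul_im, Complex.I_re,
      Complex.I_im, Complex.ofReal_re, Complex.ofReal_im, Complex.conj_re, Complex.conj_im]
    ring
  · have h₂ := integral_im hI₂
    have h₃ := integral_im hI₃
    simp only [RCLike.im_to_complex] at h₂ h₃
    have hI₄' : IntegrableOn (fun r => deriv γ r * ‖v r‖ ^ 2 * Real.sinh r ^ (d - 1)) (Ioi 0) := by
      simpa only [RCLike.re_to_complex, Complex.ofReal_re, IntegrableOn] using hI₄.re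
    have hI₃' := hI₃.im
    simp only [RCLike.im_to_complex] at hI₃'
    rw [← h₂, ← h₃, ← integral_const_mul, ← integral_add (hI₄'.const_mul κ) hI₃']
    refine setIntegral_congr_fun measurableSet_Ioi fun r _ => ?_
    simp only [Complex.sq_norm, Complex.normSq_apply]
    simp only [Complex.add_im, Complex.add_re, Complex.sub_re, Complex.sub_im, Complex.mul_re,
      Complex.mul_im, Complex.I_re, Complex.I_im, Complex.ofReal_re, Complex.ofReal_im,
      Complex.conj_re, Complex.conj_im]
    ring
end

section
/- Positivity of the low-frequency commutator weight (Lemma 5.3, inequality (5.6)): for every C ≥ 1 there exists η₀ > 0 depending only on C with the following property. Let η ∈ (0, η₀], let α : [0,∞) → (0,∞) be smooth with α′(y) = 0 for 0 ≤ y ≤ 1 and |α′(y)| ≤ C η α(y)/y, |α″(y)| ≤ C η α(y)/y² for y ≥ 1, and let β(r) = ∫₀^r α(y)/⟨y⟩ dy. Then for every integer d ≥ 2 and every r > 0, (1/2) U(r) β′(r) − β″(r)/(2r) − β‴(r)/4 ≥ 0. -/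
open MeasureTheory Set

/-- The Japanese bracket `⟨y⟩ = (1+y²)^{1/2}`. -/
noncomputable def jap (y : ℝ) : ℝ := Real.sqrt (1 + y ^ 2)

/-- The low-frequency multiplier weight `β(r) = ∫₀^r α(y)/⟨y⟩ dy`. -/
noncomputable def betaLow (α : ℝ → ℝ) (r : ℝ) : ℝ := ∫ y in (0 : ℝ)..r, α y / jap y

/-- `sinh r ≥ (9/8) r` for `r ≥ 1`. -/
lemma nine_eighths_mul_le_sinh {r : ℝ} (hr : 1 ≤ r) : 9 / 8 * r ≤ Real.sinh r := by
  have h1 : r / 2 ≤ Real.sinh (r / 2) := Real.self_le_sinh_iff.2 (by linarith)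
  have h2 : 1 + (r / 2) ^ 2 / 2 ≤ Real.cosh (r / 2) := by
    have h := Real.cosh_sq (r / 4)
    have h' := Real.cosh_two_mul (r / 4)
    have h3 : r / 4 ≤ Real.sinh (r / 4) := Real.self_le_sinh_iff.2 (by linarith)
    rw [show 2 * (r / 4) = r / 2 by ring] at h'
    nlinarith
  have h3 : Real.sinh r = 2 * Real.sinh (r / 2) * Real.cosh (r / 2) := by
    rw [← Real.sinh_two_mul]; congr 1; ring
  have h4 : 9 / 8 ≤ Real.cosh (r / 2) := by nlinarith
  rw [h3]
  nlinarith

lemma Upot_nonneg {d : ℕ} (hd : 2 ≤ d) {r : ℝ} (hr : 0 < r) : 0 ≤ Upot d r := by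
  unfold Upot
  split_ifs with h
  · have h1 : r ≤ Real.sinh r := Real.self_le_sinh_iff.2 hr.le
    have : (Real.sinh r ^ 2)⁻¹ ≤ (r ^ 2)⁻¹ := by gcongr
    linarith
  · have h3 : (3 : ℝ) ≤ d := by exact_mod_cast (by omega : 3 ≤ d)
    have : 0 ≤ ((d : ℝ) - 1) * ((d : ℝ) - 3) := mul_nonneg (by linarith) (by linarith)
    positivity

lemma Upot_lower_bound {d : ℕ} (hd : 2 ≤ d) {r : ℝ} (hr : 1 ≤ r) :
    1 / 20 * (r ^ 2)⁻¹ ≤ Upot d r := by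
  have hr0 : 0 < r := by linarith
  have hpos : 0 < (r ^ 2)⁻¹ := by positivity
  unfold Upot
  split_ifs with h
  · have h1 : (Real.sinh r ^ 2)⁻¹ ≤ ((9 / 8 * r) ^ 2)⁻¹ := by
      have := nine_eighths_mul_le_sinh hr
      gcongr
    have h2 : ((9 / 8 * r) ^ 2)⁻¹ = 64 / 81 * (r ^ 2)⁻¹ := by
      rw [mul_pow, mul_inv]; norm_num
    linarith
  · have h3 : (3 : ℝ) ≤ d := by exact_mod_cast (by omega : 3 ≤ d)
    have h4 : 0 ≤ ((d : ℝ) - 1) * ((d : ℝ) - 3) := mul_nonneg (by linarith) (by linarith)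
    have h5 : 0 ≤ (((d : ℝ) - 1) * ((d : ℝ) - 3) / 4) * (Real.sinh r ^ 2)⁻¹ := by positivity
    linarith

lemma jap_pos (y : ℝ) : 0 < jap y := Real.sqrt_pos.2 (by positivity)

lemma jap_sq (y : ℝ) : jap y ^ 2 = 1 + y ^ 2 := Real.sq_sqrt (by positivity)

lemma hasDerivAt_jap (y : ℝ) : HasDerivAt jap (y / jap y) y := by
  have h : HasDerivAt (fun y : ℝ => 1 + y ^ 2) (2 * y) y := by
    simpa using (hasDerivAt_pow 2 y).const_add 1
  refine (h.sqrt (by positivity)).congr_deriv ?_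
  rw [mul_div_mul_left _ _ two_ne_zero, jap]

lemma continuous_jap : Continuous jap :=
  continuous_iff_continuousAt.2 fun y => (hasDerivAt_jap y).continuousAt

lemma hasDerivAt_of_contDiffOn_Ici {f : ℝ → ℝ} (hf : ContDiffOn ℝ 1 f (Ici 0)) {x : ℝ}
    (hx : 0 < x) : HasDerivAt f (derivWithin f (Ici 0) x) x :=
  ((hf.differentiableOn one_ne_zero) x hx.le).hasDerivWithinAt.hasDerivAt (Ici_mem_nhds hx)

/-- The fundamental theorem of calculus for `β` on `(0,∞)`. -/
lemma deriv_betaLow {α : ℝ → ℝ} (hα : ContinuousOn α (Ici 0)) {x : ℝ} (hx : 0 < x) :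
    deriv (betaLow α) x = α x / jap x := by
  have hc : ContinuousOn (fun y => α y / jap y) (Ici 0) :=
    hα.div continuous_jap.continuousOn fun y _ => (jap_pos y).ne'
  refine (intervalIntegral.integral_hasDerivAt_right ?_ ?_ ?_).deriv
  · refine (hc.mono ?_).intervalIntegrable
    rw [uIcc_of_le hx.le]
    exact Icc_subset_Ici_self
  · exact (hc.mono Ioi_subset_Ici_self).stronglyMeasurableAtFilter isOpen_Ioi x hx
  · exact hc.continuousAt (Ici_mem_nhds hx)

lemma deriv_deriv_betaLow {α α₁ : ℝ → ℝ} (hα : ContinuousOn α (Ici 0))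
    (h₁ : ∀ x > 0, HasDerivAt α (α₁ x) x) {x : ℝ} (hx : 0 < x) :
    deriv (deriv (betaLow α)) x = α₁ x / jap x - α x * x / jap x ^ 3 := by
  have he : deriv (betaLow α) =ᶠ[nhds x] fun y => α y / jap y := by
    filter_upwards [Ioi_mem_nhds hx] with y hy using deriv_betaLow hα hy
  rw [he.deriv_eq]
  have hj := (jap_pos x).ne'
  refine (((h₁ x hx).fun_div (hasDerivAt_jap x) hj).congr_deriv ?_).deriv
  field_simp

lemma deriv_deriv_deriv_betaLow {α α₁ α₂ : ℝ → ℝ} (hα : ContinuousOn α (Ici 0))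
    (h₁ : ∀ x > 0, HasDerivAt α (α₁ x) x) (h₂ : ∀ x > 0, HasDerivAt α₁ (α₂ x) x)
    {x : ℝ} (hx : 0 < x) :
    deriv (deriv (deriv (betaLow α))) x =
      α₂ x / jap x - 2 * α₁ x * x / jap x ^ 3 - α x / jap x ^ 3
        + 3 * α x * x ^ 2 / jap x ^ 5 := by
  have he : deriv (deriv (betaLow α)) =ᶠ[nhds x]
      fun y => α₁ y / jap y - α y * y / jap y ^ 3 := by
    filter_upwards [Ioi_mem_nhds hx] with y hy using deriv_deriv_betaLow hα h₁ hy
  rw [he.deriv_eq]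
  have hj := (jap_pos x).ne'
  refine ((((h₂ x hx).fun_div (hasDerivAt_jap x) hj).fun_sub
    (((h₁ x hx).fun_mul (hasDerivAt_id' x)).fun_div ((hasDerivAt_jap x).fun_pow 3)
      (pow_ne_zero 3 hj))).congr_deriv ?_).deriv
  push_cast
  field_simp
  ring

/-- The commutator weight in terms of `α` and its derivatives. -/
lemma commutator_weight_eq {α α₁ α₂ : ℝ → ℝ} (hα : ContinuousOn α (Ici 0))
    (h₁ : ∀ x > 0, HasDerivAt α (α₁ x) x) (h₂ : ∀ x > 0, HasDerivAt α₁ (α₂ x) x)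
    (u : ℝ) {r : ℝ} (hr : 0 < r) :
    (1 / 2) * u * deriv (betaLow α) r - deriv (deriv (betaLow α)) r / (2 * r)
        - deriv (deriv (deriv (betaLow α))) r / 4 =
      (jap r)⁻¹ * (α r * (u / 2 + 3 / (4 * (1 + r ^ 2) ^ 2))
        - α₁ r / (2 * r * (1 + r ^ 2)) - α₂ r / 4) := by
  rw [deriv_betaLow hα hr, deriv_deriv_betaLow hα h₁ hr,
    deriv_deriv_deriv_betaLow hα h₁ h₂ hr, ← jap_sq r]
  have hj := (jap_pos r).ne'
  have hs : r ^ 2 = jap r ^ 2 - 1 := by rw [jap_sq]; ring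
  field_simp
  rw [hs]
  linear_combination 4 * jap r ^ 2 * α₁ r * hs

/-- **Positivity of the low-frequency commutator weight** (Lemma 5.3,
inequality (5.6)): for every `C ≥ 1` there exists `η₀ > 0` depending only on `C`
such that for `η ∈ (0,η₀]` and any smooth `α : [0,∞) → (0,∞)` with `α′ = 0` on
`[0,1]`, `|α′(y)| ≤ C η α(y)/y` and `|α″(y)| ≤ C η α(y)/y²` for `y ≥ 1`, one has,
with `β(r) = ∫₀^r α(y)/⟨y⟩ dy`, for every `d ≥ 2` and `r > 0`:
`(1/2) U(r) β′(r) − β″(r)/(2r) − β‴(r)/4 ≥ 0`. -/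
theorem low_freq_commutator_weight_positivity (C : ℝ) (hC : 1 ≤ C) :
    ∃ η₀ > (0 : ℝ), ∀ η : ℝ, 0 < η → η ≤ η₀ →
      ∀ α : ℝ → ℝ,
        ContDiffOn ℝ (⊤ : ℕ∞) α (Ici (0 : ℝ)) →
        (∀ y ∈ Ici (0 : ℝ), 0 < α y) →
        (∀ y ∈ Icc (0 : ℝ) 1, derivWithin α (Ici 0) y = 0) →
        (∀ y ≥ (1 : ℝ), |derivWithin α (Ici 0) y| ≤ C * η * α y / y) →
        (∀ y ≥ (1 : ℝ),
          |derivWithin (derivWithin α (Ici 0)) (Ici 0) y| ≤ C * η * α y / y ^ 2) →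
        ∀ d : ℕ, 2 ≤ d → ∀ r > (0 : ℝ),
          0 ≤ (1 / 2) * Upot d r * deriv (betaLow α) r
              - deriv (deriv (betaLow α)) r / (2 * r)
              - deriv (deriv (deriv (betaLow α))) r / 4 := by
  refine ⟨1 / (20 * C), by positivity, ?_⟩
  intro η hη hη₀ α hα hpos hα₁ hb₁ hb₂ d hd r hr
  have hα' : ContDiffOn ℝ 1 (derivWithin α (Ici 0)) (Ici 0) :=
    (contDiffOn_infty.1 hα 2).derivWithin (uniqueDiffOn_Ici 0)
      (by rw [one_add_one_eq_two, Nat.cast_ofNat])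
  rw [commutator_weight_eq hα.continuousOn
    (fun x hx => hasDerivAt_of_contDiffOn_Ici (hα.of_le (by exact_mod_cast le_top)) hx)
    (fun x hx => hasDerivAt_of_contDiffOn_Ici hα' hx) _ hr]
  refine mul_nonneg (inv_nonneg.2 (jap_pos r).le) ?_
  have ha : 0 < α r := hpos r hr.le
  have hU := Upot_nonneg hd hr
  rcases lt_or_ge r 1 with hr1 | hr1
  · have h1 : derivWithin α (Ici 0) r = 0 := hα₁ r ⟨hr.le, hr1.le⟩
    have h2 : derivWithin (derivWithin α (Ici 0)) (Ici 0) r = 0 := by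
      have he : derivWithin α (Ici 0) =ᶠ[nhds r] fun _ => 0 := by
        filter_upwards [Icc_mem_nhds hr hr1] with y hy using hα₁ y hy
      rw [← (hasDerivAt_of_contDiffOn_Ici hα' hr).deriv, he.deriv_eq, deriv_const]
    rw [h1, h2]
    simp only [zero_div, sub_zero]
    positivity
  · have hCη : C * η ≤ 1 / 20 := by
      calc C * η ≤ C * (1 / (20 * C)) := by gcongr
        _ = 1 / 20 := by field_simp
    have hU' := Upot_lower_bound hd hr1
    set q := (r ^ 2)⁻¹ with hq
    have hq0 : 0 < q := by positivity
    have h1 : derivWithin α (Ici 0) r / (2 * r * (1 + r ^ 2)) ≤ 1 / 80 * α r * q := by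
      calc _ ≤ (C * η * α r / r) / (2 * r * (1 + r ^ 2)) := by
            gcongr
            exact (le_abs_self _).trans (hb₁ r hr1)
        _ ≤ (1 / 20 * α r / r) / (2 * r * (1 + 1 ^ 2)) := by gcongr
        _ = _ := by rw [hq]; field_simp; norm_num
    have h2 : derivWithin (derivWithin α (Ici 0)) (Ici 0) r ≤ 1 / 20 * α r * q := by
      calc _ ≤ C * η * α r / r ^ 2 := (le_abs_self _).trans (hb₂ r hr1)
        _ ≤ 1 / 20 * α r / r ^ 2 := by gcongr
        _ = _ := by rw [hq]; rfl
    have h3 : α r * (1 / 40 * q) ≤ α r * (Upot d r / 2 + 3 / (4 * (1 + r ^ 2) ^ 2)) := by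
      have : 0 ≤ 3 / (4 * (1 + r ^ 2) ^ 2) := by positivity
      gcongr
      linarith
    linarith
end

section
/- Lower bounds for the low-frequency commutator weight with the angular term (Lemma 5.3, inequalities (5.7) and (5.8)): for every C ≥ 1 there exists η₀ > 0 depending only on C, and for every integer d ≥ 2 and every c ∈ (0,1] there exist constants C″, R ≥ 1 depending only on d, C, c, such that for every η ∈ (0, η₀], every (C,c,η)-admissible α, and every r > 0, with β(r) = ∫₀^r α(y)/⟨y⟩ dy: (a) (1/2) U(r) β′(r) − β″(r)/(2r) − β‴(r)/4 − (β(r) coth(r) − β′(r))/(4 sinh(r)²) ≥ −C″ · 1_{(0,R]}(r); and (b) 0 ≤ (β(r) coth(r) − β′(r))/sinh(r)² ≤ C″ ( β′(r)/⟨r⟩² + 1_{(0,R]}(r) ). -/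
open MeasureTheory Set

/-- A `(C,c,η)`-admissible weight: a smooth function `α : [0,∞) → (0,∞)` such that
`α′(y) = 0` for `0 ≤ y ≤ 1`; `|α^{(j)}(y)| ≤ C α(y)/⟨y⟩^j` for `j = 1,2,3` and all
`y ≥ 0`; `|α′(y)| ≤ C η α(y)/y` and `|α″(y)| ≤ C η α(y)/y²` for `y ≥ 1`;
`α(y) ≥ c ⟨y⟩^{−η}` for all `y ≥ 0`; `y ↦ α(y)/⟨y⟩` is nonincreasing; and
`∫₀^∞ α(y)/⟨y⟩ dy ≤ C`. -/
structure IsAdmissible (C c η : ℝ) (α : ℝ → ℝ) : Prop where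
  smooth : ContDiffOn ℝ (⊤ : ℕ∞) α (Ici (0 : ℝ))
  pos : ∀ y ∈ Ici (0 : ℝ), 0 < α y
  deriv_eq_zero : ∀ y ∈ Icc (0 : ℝ) 1, derivWithin α (Ici 0) y = 0
  deriv1_le : ∀ y ∈ Ici (0 : ℝ), |derivWithin α (Ici 0) y| ≤ C * α y / jap y
  deriv2_le : ∀ y ∈ Ici (0 : ℝ),
    |derivWithin (derivWithin α (Ici 0)) (Ici 0) y| ≤ C * α y / jap y ^ 2
  deriv3_le : ∀ y ∈ Ici (0 : ℝ),
    |derivWithin (derivWithin (derivWithin α (Ici 0)) (Ici 0)) (Ici 0) y|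
      ≤ C * α y / jap y ^ 3
  deriv1_le' : ∀ y ≥ (1 : ℝ), |derivWithin α (Ici 0) y| ≤ C * η * α y / y
  deriv2_le' : ∀ y ≥ (1 : ℝ),
    |derivWithin (derivWithin α (Ici 0)) (Ici 0) y| ≤ C * η * α y / y ^ 2
  lower : ∀ y ∈ Ici (0 : ℝ), c * jap y ^ (-η) ≤ α y
  antitone : AntitoneOn (fun y => α y / jap y) (Ici (0 : ℝ))
  integrable : IntegrableOn (fun y => α y / jap y) (Ioi (0 : ℝ))
  integral_le : (∫ y in Ioi (0 : ℝ), α y / jap y) ≤ C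

lemma one_le_jap (y : ℝ) : 1 ≤ jap y := by
  nlinarith [jap_sq y, jap_pos y, sq_nonneg y]

lemma le_jap (y : ℝ) : y ≤ jap y := by
  nlinarith [jap_sq y, jap_pos y]

lemma sinh_le_mul_cosh {r : ℝ} (hr : 0 ≤ r) : Real.sinh r ≤ r * Real.cosh r := by
  have hd : ∀ x : ℝ, HasDerivAt (fun x => x * Real.cosh x - Real.sinh x) (x * Real.sinh x) x := by
    intro x
    refine (((hasDerivAt_id x).mul (Real.hasDerivAt_cosh x)).sub
      (Real.hasDerivAt_sinh x)).congr_deriv ?_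
    simp
  have hm : MonotoneOn (fun x => x * Real.cosh x - Real.sinh x) (Ici (0 : ℝ)) := by
    refine monotoneOn_of_hasDerivWithinAt_nonneg (convex_Ici 0)
      (fun x _ => (hd x).continuousAt.continuousWithinAt) (fun x _ => (hd x).hasDerivWithinAt) ?_
    intro x hx
    have hx0 : 0 ≤ x := interior_subset hx
    exact mul_nonneg hx0 (Real.sinh_nonneg_iff.2 hx0)
  have := hm (mem_Ici.2 le_rfl) (mem_Ici.2 hr) hr
  simp at this
  linarith

lemma mul_cosh_le {r : ℝ} (hr : 0 ≤ r) : r * Real.cosh r ≤ (1 + r ^ 2) * Real.sinh r := by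
  have hd : ∀ x : ℝ, HasDerivAt (fun x => (1 + x ^ 2) * Real.sinh x - x * Real.cosh x)
      (x * Real.sinh x + x ^ 2 * Real.cosh x) x := by
    intro x
    refine ((((hasDerivAt_pow 2 x).const_add 1).mul (Real.hasDerivAt_sinh x)).sub
      ((hasDerivAt_id x).mul (Real.hasDerivAt_cosh x))).congr_deriv ?_
    simp
    ring
  have hm : MonotoneOn (fun x => (1 + x ^ 2) * Real.sinh x - x * Real.cosh x) (Ici (0 : ℝ)) := by
    refine monotoneOn_of_hasDerivWithinAt_nonneg (convex_Ici 0)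
      (fun x _ => (hd x).continuousAt.continuousWithinAt) (fun x _ => (hd x).hasDerivWithinAt) ?_
    intro x hx
    have hx0 : 0 ≤ x := interior_subset hx
    have := Real.sinh_nonneg_iff.2 hx0
    have := Real.cosh_pos x
    positivity
  have := hm (mem_Ici.2 le_rfl) (mem_Ici.2 hr) hr
  simp at this
  linarith

lemma inv_le_cothR {r : ℝ} (hr : 0 < r) : r⁻¹ ≤ cothR r := by
  have hs := Real.sinh_pos_iff.2 hr
  unfold cothR
  rw [le_div_iff₀ hs, inv_mul_le_iff₀ hr]
  exact sinh_le_mul_cosh hr.le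

lemma mul_cothR_le {r : ℝ} (hr : 0 < r) : r * cothR r ≤ 1 + r ^ 2 := by
  have hs := Real.sinh_pos_iff.2 hr
  unfold cothR
  rw [← mul_div_assoc, div_le_iff₀ hs]
  exact mul_cosh_le hr.le

lemma self_le_sinh {r : ℝ} (hr : 0 ≤ r) : r ≤ Real.sinh r := Real.self_le_sinh_iff.2 hr

lemma cothR_le_two {r : ℝ} (hr : 1 ≤ r) : cothR r ≤ 2 := by
  have hs := self_le_sinh (zero_le_one.trans hr)
  unfold cothR
  rw [div_le_iff₀ (by linarith)]
  have h1 := Real.cosh_sub_sinh r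
  have h2 : Real.exp (-r) ≤ 1 := Real.exp_le_one_iff.2 (by linarith)
  linarith

lemma cube_div_le_sinh {r : ℝ} (hr : 0 ≤ r) : r ^ 3 / 12 ≤ Real.sinh r := by
  have h := Real.sum_le_exp_of_nonneg hr 4
  norm_num [Finset.sum_range_succ, Nat.factorial] at h
  have h2 : Real.exp (-r) ≤ 1 := Real.exp_le_one_iff.2 (by linarith)
  rw [Real.sinh_eq]
  nlinarith [sq_nonneg r]

lemma jap_pow_four_le_sinh_sq {C c r : ℝ} (hC : 1 ≤ C) (hc : 0 < c) (hc1 : c ≤ 1)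
    (hr : 5000 * C / c ≤ r) : 8 * C * jap r ^ 4 ≤ c * Real.sinh r ^ 2 := by
  have hR : 5000 * C ≤ c * r := by rw [div_le_iff₀ hc] at hr; linarith
  have hr1 : 1 ≤ r := by nlinarith
  have hs := cube_div_le_sinh (zero_le_one.trans hr1)
  have hs2 : (r ^ 3 / 12) ^ 2 ≤ Real.sinh r ^ 2 := by gcongr
  have hJ : jap r ^ 4 ≤ 4 * r ^ 4 := by
    have : jap r ^ 4 = (1 + r ^ 2) ^ 2 := by rw [← jap_sq]; ring
    rw [this, show 4 * r ^ 4 = (2 * r ^ 2) ^ 2 by ring]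
    gcongr
    nlinarith
  have h1 : 5000 * C * r ^ 4 ≤ c * r * r * r ^ 4 := by
    have : 5000 * C ≤ c * r * r := by nlinarith
    gcongr
  calc 8 * C * jap r ^ 4 ≤ 8 * C * (4 * r ^ 4) := by gcongr
    _ ≤ c * (r ^ 3 / 12) ^ 2 := by nlinarith [show 0 ≤ C * r ^ 4 by positivity]
    _ ≤ _ := by gcongr

lemma sub_inv_sinh_le_Upot {d : ℕ} (hd : 2 ≤ d) (r : ℝ) :
    (1 / 4) * ((r ^ 2)⁻¹ - (Real.sinh r ^ 2)⁻¹) ≤ Upot d r := by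
  unfold Upot
  split_ifs with h
  · rfl
  · have h3 : (3 : ℝ) ≤ d := by exact_mod_cast (by omega : 3 ≤ d)
    have h1 : 0 ≤ ((d : ℝ) - 1) * ((d : ℝ) - 3) / 4 := by
      have : 0 ≤ ((d : ℝ) - 1) * ((d : ℝ) - 3) := mul_nonneg (by linarith) (by linarith)
      linarith
    have h2 : 0 ≤ (Real.sinh r ^ 2)⁻¹ := by positivity
    nlinarith [mul_nonneg h1 h2]

namespace IsAdmissible

variable {C c η : ℝ} {α : ℝ → ℝ}

lemma continuousOn_div_jap (h : IsAdmissible C c η α) :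
    ContinuousOn (fun y => α y / jap y) (Ici (0 : ℝ)) :=
  h.smooth.continuousOn.div continuous_jap.continuousOn fun y _ => (jap_pos y).ne'

lemma intervalIntegrable (h : IsAdmissible C c η α) {r : ℝ} (hr : 0 ≤ r) :
    IntervalIntegrable (fun y => α y / jap y) volume 0 r := by
  refine (h.continuousOn_div_jap.mono ?_).intervalIntegrable
  rw [uIcc_of_le hr]
  exact Icc_subset_Ici_self

lemma hasDerivAt_betaLow (h : IsAdmissible C c η α) {r : ℝ} (hr : 0 < r) :
    HasDerivAt (betaLow α) (α r / jap r) r := by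
  have hn : Ici (0 : ℝ) ∈ nhds r := Ici_mem_nhds hr
  exact intervalIntegral.integral_hasDerivAt_right (h.intervalIntegrable hr.le)
    (h.continuousOn_div_jap.stronglyMeasurableAtFilter_nhdsWithin measurableSet_Ici r
      |>.filter_mono (by rw [nhdsWithin_eq_nhds.2 hn]))
    (h.continuousOn_div_jap.continuousAt hn)

lemma hasDerivAt (h : IsAdmissible C c η α) {r : ℝ} (hr : 0 < r) :
    HasDerivAt α (derivWithin α (Ici 0) r) r :=
  ((h.smooth.differentiableOn (by simp)) r hr.le).hasDerivWithinAt.hasDerivAt (Ici_mem_nhds hr)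

lemma hasDerivAt_derivWithin (h : IsAdmissible C c η α) {r : ℝ} (hr : 0 < r) :
    HasDerivAt (derivWithin α (Ici 0)) (derivWithin (derivWithin α (Ici 0)) (Ici 0) r) r := by
  have h1 : ContDiffOn ℝ 1 (derivWithin α (Ici 0)) (Ici (0 : ℝ)) :=
    h.smooth.derivWithin (uniqueDiffOn_Ici 0) (WithTop.coe_le_coe.2 (le_top (a := (1 + 1 : ℕ∞))))
  exact ((h1.differentiableOn (by simp)) r hr.le).hasDerivWithinAt.hasDerivAt (Ici_mem_nhds hr)

lemma deriv_betaLow (h : IsAdmissible C c η α) {r : ℝ} (hr : 0 < r) :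
    deriv (betaLow α) r = α r / jap r := (h.hasDerivAt_betaLow hr).deriv

lemma hasDerivAt_deriv_betaLow (h : IsAdmissible C c η α) {r : ℝ} (hr : 0 < r) :
    HasDerivAt (deriv (betaLow α))
      (derivWithin α (Ici 0) r / jap r - α r * r / jap r ^ 3) r := by
  have hJ := (jap_pos r).ne'
  have h1 := (h.hasDerivAt hr).div (hasDerivAt_jap r) hJ
  refine (h1.congr_of_eventuallyEq ?_).congr_deriv ?_
  · filter_upwards [Ioi_mem_nhds hr] with x hx using h.deriv_betaLow hx
  · field_simp

lemma hasDerivAt_deriv_deriv_betaLow (h : IsAdmissible C c η α) {r : ℝ} (hr : 0 < r) :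
    HasDerivAt (deriv (deriv (betaLow α)))
      (derivWithin (derivWithin α (Ici 0)) (Ici 0) r / jap r
        - 2 * derivWithin α (Ici 0) r * r / jap r ^ 3
        + α r * (2 * r ^ 2 - 1) / jap r ^ 5) r := by
  have hJ := (jap_pos r).ne'
  have h1 := ((h.hasDerivAt_derivWithin hr).div (hasDerivAt_jap r) hJ).sub
    (((h.hasDerivAt hr).mul (hasDerivAt_id r)).div ((hasDerivAt_jap r).pow 3) (pow_ne_zero 3 hJ))
  refine (h1.congr_of_eventuallyEq ?_).congr_deriv ?_
  · filter_upwards [Ioi_mem_nhds hr] with x hx using (h.hasDerivAt_deriv_betaLow hx).deriv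
  · have h2 : 2 * r ^ 2 - 1 = 3 * r ^ 2 - jap r ^ 2 := by rw [jap_sq]; ring
    rw [h2]
    simp
    field_simp
    ring

lemma deriv_deriv_betaLow_nonpos (h : IsAdmissible C c η α) {r : ℝ} (hr : 0 < r) :
    deriv (deriv (betaLow α)) r ≤ 0 := by
  have h1 : AntitoneOn (deriv (betaLow α)) (Ioi 0) := by
    intro x hx y hy hxy
    rw [h.deriv_betaLow hx, h.deriv_betaLow hy]
    exact h.antitone (mem_Ioi.1 hx).le (mem_Ioi.1 hy).le hxy
  have h2 := h1.derivWithin_nonpos (x := r)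
  rwa [derivWithin_of_mem_nhds (Ioi_mem_nhds hr)] at h2

lemma betaLow_le (h : IsAdmissible C c η α) {r : ℝ} (hr : 0 ≤ r) : betaLow α r ≤ C := by
  refine le_trans ?_ h.integral_le
  unfold betaLow
  rw [intervalIntegral.integral_of_le hr]
  refine setIntegral_mono_set h.integrable ?_ (Ioc_subset_Ioi_self.eventuallyLE)
  filter_upwards [ae_restrict_mem measurableSet_Ioi] with y hy
  exact (div_pos (h.pos y (mem_Ioi.1 hy).le) (jap_pos y)).le

lemma mul_le_betaLow (h : IsAdmissible C c η α) {r : ℝ} (hr : 0 ≤ r) :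
    r * (α r / jap r) ≤ betaLow α r := by
  have := intervalIntegral.integral_mono_on hr (intervalIntegrable_const (c := α r / jap r))
    (h.intervalIntegrable hr) (fun x hx => h.antitone hx.1 hr hx.2)
  simpa [betaLow, mul_div_assoc] using this

lemma betaLow_le_mul (h : IsAdmissible C c η α) {r : ℝ} (hr : 0 ≤ r) :
    betaLow α r ≤ r * α 0 := by
  have := intervalIntegral.integral_mono_on hr (h.intervalIntegrable hr)
    (intervalIntegrable_const (c := α 0 / jap 0))
    (fun x hx => h.antitone (mem_Ici.2 le_rfl) hx.1 hx.1)
  simpa [betaLow, jap] using this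

lemma eq_zero_value (h : IsAdmissible C c η α) {r : ℝ} (hr : r ∈ Icc (0 : ℝ) 1) :
    α r = α 0 := by
  refine constant_of_has_deriv_right_zero (h.smooth.continuousOn.mono Icc_subset_Ici_self) ?_ r hr
  intro x hx
  have := ((h.smooth.differentiableOn (by simp)) x hx.1).hasDerivWithinAt
  rw [h.deriv_eq_zero x ⟨hx.1, hx.2.le⟩] at this
  exact this.mono (Ici_subset_Ici.2 hx.1)

lemma value_zero_le (h : IsAdmissible C c η α) (hC : 1 ≤ C) : α 0 ≤ 2 * C := by
  have h1 := h.mul_le_betaLow zero_le_one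
  have h2 := h.betaLow_le zero_le_one
  rw [h.eq_zero_value (r := 1) (by simp), one_mul] at h1
  have h3 := h1.trans h2
  rw [div_le_iff₀ (jap_pos 1)] at h3
  have : jap 1 ≤ 2 := by nlinarith [jap_sq 1, jap_pos 1]
  nlinarith

lemma div_jap_le (h : IsAdmissible C c η α) (hC : 1 ≤ C) {r : ℝ} (hr : 0 ≤ r) :
    α r / jap r ≤ 2 * C := by
  have h1 := h.antitone (mem_Ici.2 le_rfl) hr hr
  simp [jap] at h1
  exact h1.trans (h.value_zero_le hC)

lemma div_jap_le_value (h : IsAdmissible C c η α) (hη : η ≤ 1) (hc : 0 ≤ c) {r : ℝ}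
    (hr : 0 ≤ r) : c / jap r ≤ α r := by
  refine le_trans ?_ (h.lower r hr)
  rw [div_eq_mul_inv, ← Real.rpow_neg_one]
  gcongr
  exact one_le_jap r

lemma angular_nonneg (h : IsAdmissible C c η α) {r : ℝ} (hr : 0 < r) :
    0 ≤ (betaLow α r * cothR r - deriv (betaLow α) r) / Real.sinh r ^ 2 := by
  refine div_nonneg ?_ (sq_nonneg _)
  rw [h.deriv_betaLow hr, sub_nonneg]
  have h1 := h.mul_le_betaLow hr.le
  have h0 : 0 ≤ α r / jap r := (div_pos (h.pos r hr.le) (jap_pos r)).le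
  calc α r / jap r = (r * (α r / jap r)) * r⁻¹ := by field_simp
    _ ≤ _ := mul_le_mul h1 (inv_le_cothR hr) (by positivity)
      ((mul_nonneg hr.le h0).trans h1)

lemma betaLow_nonneg (h : IsAdmissible C c η α) {r : ℝ} (hr : 0 ≤ r) : 0 ≤ betaLow α r :=
  (mul_nonneg hr (div_pos (h.pos r hr) (jap_pos r)).le).trans (h.mul_le_betaLow hr)

lemma betaLow_mul_cothR_le (h : IsAdmissible C c η α) {r : ℝ} (hr : 1 ≤ r) :
    betaLow α r * cothR r ≤ 2 * C := by
  have hr0 := zero_le_one.trans hr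
  have h1 := h.betaLow_le hr0
  have h2 := cothR_le_two hr
  have h3 := h.betaLow_nonneg hr0
  nlinarith

lemma angular_le (h : IsAdmissible C c η α) (hC : 1 ≤ C) {r : ℝ} (hr : 0 < r) :
    (betaLow α r * cothR r - deriv (betaLow α) r) / Real.sinh r ^ 2 ≤ 4 * C := by
  have hs := self_le_sinh hr.le
  have hs2 : r ^ 2 ≤ Real.sinh r ^ 2 := by gcongr
  rw [div_le_iff₀ (by positivity [Real.sinh_pos_iff.2 hr]), h.deriv_betaLow hr]
  rcases le_total r 1 with hr1 | hr1
  · rw [h.eq_zero_value ⟨hr.le, hr1⟩]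
    have ha := h.value_zero_le hC
    have ha0 := h.pos 0 (mem_Ici.2 le_rfl)
    have h1 : betaLow α r * cothR r ≤ α 0 * (1 + r ^ 2) := by
      have hco : 0 ≤ cothR r := (inv_pos.2 hr).le.trans (inv_le_cothR hr)
      calc betaLow α r * cothR r ≤ (r * α 0) * cothR r := by
            gcongr; exact h.betaLow_le_mul hr.le
        _ = α 0 * (r * cothR r) := by ring
        _ ≤ _ := by gcongr; exact mul_cothR_le hr
    have h2 : α 0 * (1 - r ^ 2) ≤ α 0 / jap r := by
      rw [le_div_iff₀ (jap_pos r), mul_assoc]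
      refine mul_le_of_le_one_right ha0.le ?_
      have hJ : jap r ≤ 1 + r ^ 2 := by nlinarith [jap_sq r, one_le_jap r]
      nlinarith [sq_nonneg r, mul_le_mul_of_nonneg_left hJ (by nlinarith : 0 ≤ 1 - r ^ 2)]
    nlinarith [sq_nonneg r]
  · have h1 := h.betaLow_mul_cothR_le hr1
    have h2 : 0 < α r / jap r := div_pos (h.pos r hr.le) (jap_pos r)
    have h3 : 1 ≤ Real.sinh r ^ 2 := by nlinarith
    nlinarith

lemma deriv_three_betaLow_le (h : IsAdmissible C c η α) (hC : 1 ≤ C) {r : ℝ} (hr : 0 < r) :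
    deriv (deriv (deriv (betaLow α))) r ≤ 10 * C ^ 2 := by
  rw [(h.hasDerivAt_deriv_deriv_betaLow hr).deriv]
  have hJ := jap_pos r
  have hJ1 := one_le_jap r
  have hrJ := le_jap r
  have ha := h.div_jap_le hC hr.le
  have hap := h.pos r hr.le
  have hg : 0 < α r / jap r := by positivity
  have h1 := (abs_le.1 (h.deriv1_le r hr.le)).1
  have h2 := (abs_le.1 (h.deriv2_le r hr.le)).2
  have hi : ∀ n : ℕ, 1 / jap r ^ n ≤ 1 := fun n => by
    rw [div_le_one (by positivity)]; exact one_le_pow₀ hJ1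
  have b2 : derivWithin (derivWithin α (Ici 0)) (Ici 0) r / jap r ≤ 2 * C ^ 2 := by
    calc _ ≤ (C * α r / jap r ^ 2) / jap r := by gcongr
      _ = C * (α r / jap r) * (1 / jap r ^ 2) := by field_simp
      _ ≤ C * (2 * C) * 1 := by gcongr; exact hi 2
      _ = _ := by ring
  have b1 : -(2 * derivWithin α (Ici 0) r * r / jap r ^ 3) ≤ 4 * C ^ 2 := by
    calc _ = 2 * (-derivWithin α (Ici 0) r) * r / jap r ^ 3 := by ring
      _ ≤ 2 * (C * α r / jap r) * jap r / jap r ^ 3 := by gcongr; linarith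
      _ = 2 * C * (α r / jap r) * (1 / jap r ^ 2) := by field_simp
      _ ≤ 2 * C * (2 * C) * 1 := by gcongr; exact hi 2
      _ = _ := by ring
  have b0 : α r * (2 * r ^ 2 - 1) / jap r ^ 5 ≤ 4 * C := by
    calc _ ≤ α r * (2 * jap r ^ 2) / jap r ^ 5 := by
          gcongr; rw [jap_sq]; linarith
      _ = 2 * (α r / jap r) * (1 / jap r ^ 2) := by field_simp
      _ ≤ 2 * (2 * C) * 1 := by gcongr; exact hi 2
      _ = _ := by ring
  nlinarith

lemma radial_lower (h : IsAdmissible C c η α) (hC : 1 ≤ C)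
    (hη : η ≤ 1 / (20 * C)) {r : ℝ} (hr : 1 ≤ r) :
    α r / (16 * r ^ 2 * jap r) ≤ α r / (8 * r ^ 2 * jap r)
      - deriv (deriv (betaLow α)) r / (2 * r) - deriv (deriv (deriv (betaLow α))) r / 4 := by
  have hr0 : 0 < r := by linarith
  rw [(h.hasDerivAt_deriv_deriv_betaLow hr0).deriv, (h.hasDerivAt_deriv_betaLow hr0).deriv]
  have hJ := jap_pos r
  have hrJ := le_jap r
  have hap := h.pos r hr0.le
  have hCη : C * η ≤ 1 / 20 := by
    rw [le_div_iff₀ (by positivity)] at hη; linarith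
  obtain ⟨h1l, h1u⟩ := abs_le.1 (h.deriv1_le' r hr)
  have h2 := (abs_le.1 (h.deriv2_le' r hr)).2
  set a := α r
  set a1 := derivWithin α (Ici 0) r
  set a2 := derivWithin (derivWithin α (Ici 0)) (Ici 0) r
  set J := jap r
  have hE : C * η * a / r ≤ 1 / 20 * a / r := by gcongr
  have hE2 : C * η * a / r ^ 2 ≤ 1 / 20 * a / r ^ 2 := by gcongr
  have e1 : a1 / J / (2 * r) ≤ 1 / 40 * (a / (r ^ 2 * J)) := by
    calc _ ≤ (1 / 20 * a / r) / J / (2 * r) := by gcongr; linarith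
      _ = _ := by field_simp; norm_num
  have e2 : a2 / J / 4 ≤ 1 / 80 * (a / (r ^ 2 * J)) := by
    calc _ ≤ (1 / 20 * a / r ^ 2) / J / 4 := by gcongr; linarith
      _ = _ := by field_simp; norm_num
  have e3 : -(2 * a1 * r / J ^ 3) / 4 ≤ 1 / 40 * (a / (r ^ 2 * J)) := by
    calc _ = 2 * (-a1) * r / J ^ 3 / 4 := by ring
      _ ≤ 2 * (1 / 20 * a / r) * r / (r ^ 2 * J) / 4 := by
        gcongr
        · linarith
        · calc r ^ 2 * J ≤ J ^ 2 * J := by gcongr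
            _ = J ^ 3 := by ring
      _ = _ := by field_simp; norm_num
  have e4 : 0 ≤ a * r / J ^ 3 / (2 * r) - a * (2 * r ^ 2 - 1) / J ^ 5 / 4 := by
    have : a * r / J ^ 3 / (2 * r) - a * (2 * r ^ 2 - 1) / J ^ 5 / 4
        = a * (2 * J ^ 2 - (2 * r ^ 2 - 1)) / (4 * J ^ 5) := by field_simp; ring
    rw [this, show J ^ 2 = 1 + r ^ 2 from jap_sq r]
    have : 2 * (1 + r ^ 2) - (2 * r ^ 2 - 1) = 3 := by ring
    rw [this]; positivity
  have e5 : a / (16 * r ^ 2 * J) = 1 / 16 * (a / (r ^ 2 * J)) := by field_simp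
  have e6 : a / (8 * r ^ 2 * J) = 1 / 8 * (a / (r ^ 2 * J)) := by field_simp
  rw [e5, e6, sub_div]
  linarith

end IsAdmissible

/-- **Lower bounds for the low-frequency commutator weight with the angular term**
(Lemma 5.3, inequalities (5.7) and (5.8)). -/
theorem low_freq_commutator_weight_angular_bounds :
    ∀ C : ℝ, 1 ≤ C →
    ∃ η₀ > (0 : ℝ),
      ∀ d : ℕ, 2 ≤ d → ∀ c : ℝ, 0 < c → c ≤ 1 →
      ∃ C'' ≥ (1 : ℝ), ∃ R ≥ (1 : ℝ),
        ∀ η : ℝ, 0 < η → η ≤ η₀ →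
        ∀ α : ℝ → ℝ, IsAdmissible C c η α →
        ∀ r > (0 : ℝ),
          ((1 / 2) * Upot d r * deriv (betaLow α) r
              - deriv (deriv (betaLow α)) r / (2 * r)
              - deriv (deriv (deriv (betaLow α))) r / 4
              - (betaLow α r * cothR r - deriv (betaLow α) r) / (4 * Real.sinh r ^ 2)
            ≥ -(C'' * Set.indicator (Set.Ioc (0 : ℝ) R) (fun _ => (1 : ℝ)) r))
          ∧ 0 ≤ (betaLow α r * cothR r - deriv (betaLow α) r) / Real.sinh r ^ 2
          ∧ (betaLow α r * cothR r - deriv (betaLow α) r) / Real.sinh r ^ 2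
              ≤ C'' * (deriv (betaLow α) r / jap r ^ 2
                  + Set.indicator (Set.Ioc (0 : ℝ) R) (fun _ => (1 : ℝ)) r) := by
  intro C hC
  refine ⟨1 / (20 * C), by positivity, fun d hd c hc hc1 => ?_⟩
  have hR1 : 1 ≤ 5000 * C / c := by rw [le_div_iff₀ hc]; linarith
  refine ⟨20 * C ^ 2, by nlinarith, 5000 * C / c, hR1, fun η hη0 hη α h r hr => ?_⟩
  have hη1 : η ≤ 1 := hη.trans (by rw [div_le_one (by positivity)]; linarith)
  have hs : 0 < Real.sinh r := Real.sinh_pos_iff.2 hr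
  have hJ := jap_pos r
  have hap := h.pos r hr.le
  have hg : 0 < α r / jap r := div_pos hap hJ
  have hang0 := h.angular_nonneg hr
  have hangs : (betaLow α r * cothR r - deriv (betaLow α) r) / (4 * Real.sinh r ^ 2)
      = 1 / 4 * ((betaLow α r * cothR r - deriv (betaLow α) r) / Real.sinh r ^ 2) := by
    field_simp
  have hU := sub_inv_sinh_le_Upot hd r
  refine ⟨?_, hang0, ?_⟩
  · rw [hangs]
    by_cases hrR : r ≤ 5000 * C / c
    · rw [indicator_of_mem (show r ∈ Ioc (0 : ℝ) (5000 * C / c) from ⟨hr, hrR⟩)]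
      have h3 := h.deriv_three_betaLow_le hC hr
      have h4 := h.angular_le hC hr
      have h2 : 0 ≤ -deriv (deriv (betaLow α)) r / (2 * r) :=
        div_nonneg (neg_nonneg.2 (h.deriv_deriv_betaLow_nonpos hr)) (by positivity)
      rw [neg_div] at h2
      have h5 : (Real.sinh r ^ 2)⁻¹ ≤ (r ^ 2)⁻¹ := by
        gcongr; exact self_le_sinh hr.le
      have h1 : 0 ≤ (1 / 2) * Upot d r * deriv (betaLow α) r := by
        rw [h.deriv_betaLow hr]
        exact mul_nonneg (by linarith) hg.le
      nlinarith
    · rw [indicator_of_notMem (fun hm => hrR hm.2)]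
      push Not at hrR
      have hr1 : 1 ≤ r := hR1.trans hrR.le
      have h1 := h.radial_lower hC hη hr1
      have h2 := h.betaLow_mul_cothR_le hr1
      have h3 := jap_pow_four_le_sinh_sq hC hc hc1 hrR.le
      have h4 := h.div_jap_le_value hη1 hc.le hr.le
      have h5 : C / (2 * Real.sinh r ^ 2) ≤ α r / (16 * r ^ 2 * jap r) := by
        calc C / (2 * Real.sinh r ^ 2) ≤ c / (16 * jap r ^ 4) := by
              rw [div_le_div_iff₀ (by positivity) (by positivity)]; linarith
          _ = c / jap r / (16 * jap r ^ 2 * jap r) := by field_simp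
          _ ≤ α r / (16 * r ^ 2 * jap r) := by gcongr; exact le_jap r
      have h6 : (1 / 2) * ((1 / 4) * ((r ^ 2)⁻¹ - (Real.sinh r ^ 2)⁻¹)) * (α r / jap r)
          ≤ (1 / 2) * Upot d r * (α r / jap r) := by gcongr
      have h7 : (1 / 2) * ((1 / 4) * ((r ^ 2)⁻¹ - (Real.sinh r ^ 2)⁻¹)) * (α r / jap r)
          = α r / (8 * r ^ 2 * jap r) - 1 / 8 * (α r / jap r / Real.sinh r ^ 2) := by
        field_simp
        ring
      have h8 : betaLow α r * cothR r / Real.sinh r ^ 2 ≤ 2 * C / Real.sinh r ^ 2 := by gcongr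
      have h9 : C / (2 * Real.sinh r ^ 2) = 1 / 4 * (2 * C / Real.sinh r ^ 2) := by
        field_simp; norm_num
      have h10 : 0 ≤ α r / jap r / Real.sinh r ^ 2 := by positivity
      rw [h.deriv_betaLow hr, sub_div]
      linarith
  · by_cases hrR : r ≤ 5000 * C / c
    · rw [indicator_of_mem (show r ∈ Ioc (0 : ℝ) (5000 * C / c) from ⟨hr, hrR⟩),
        h.deriv_betaLow hr]
      have h4 := h.angular_le hC hr
      rw [h.deriv_betaLow hr] at h4
      have h5 : 0 ≤ α r / jap r / jap r ^ 2 := by positivity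
      nlinarith [mul_nonneg (sq_nonneg C) h5]
    · rw [indicator_of_notMem (fun hm => hrR hm.2)]
      push Not at hrR
      have hr1 : 1 ≤ r := hR1.trans hrR.le
      have h2 := h.betaLow_mul_cothR_le hr1
      have h3 := jap_pow_four_le_sinh_sq hC hc hc1 hrR.le
      have h4 := h.div_jap_le_value hη1 hc.le hr.le
      rw [h.deriv_betaLow hr, add_zero]
      have h5 : 0 ≤ α r / jap r / jap r ^ 2 := by positivity
      calc _ ≤ 2 * C / Real.sinh r ^ 2 := by gcongr; linarith
        _ ≤ c / jap r ^ 4 := by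
          rw [div_le_div_iff₀ (by positivity) (by positivity)]
          nlinarith [show 0 ≤ C * jap r ^ 4 by positivity]
        _ = c / jap r / jap r / jap r ^ 2 := by field_simp
        _ ≤ α r / jap r / jap r ^ 2 := by gcongr
        _ ≤ _ := le_mul_of_one_le_left h5 (by nlinarith)
end

section
/- Monotonicity properties of the high-frequency multiplier weight (Lemma 6.2, inequalities (6.4) and (6.5)): let α : [0,∞) → (0,∞) be smooth with y ↦ α(y)/⟨y⟩ nonincreasing, and for s, δ > 0 let β_s(r) = s^{1/2} ∫₀^{δ s^{−1/2} r} α(y)/⟨y⟩ dy. Then for all s, δ, r > 0: β_s(r) coth(r) − ∂_r β_s(r) ≥ 0, and ∂_s ∂_r β_s(r) ≥ 0 (that is, for each fixed r > 0 the function s ↦ ∂_r β_s(r) is nondecreasing). -/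
open MeasureTheory Set

/-- The high-frequency multiplier weight
`β_s(r) = s^{1/2} ∫₀^{δ s^{−1/2} r} α(y)/⟨y⟩ dy`. -/
noncomputable def betaHigh (α : ℝ → ℝ) (δ s r : ℝ) : ℝ :=
  Real.sqrt s * ∫ y in (0 : ℝ)..(δ * r / Real.sqrt s), α y / jap y

lemma sinh_le_self_mul_cosh {r : ℝ} (hr : 0 < r) : Real.sinh r ≤ r * Real.cosh r := by
  obtain ⟨c, ⟨hc0, hcr⟩, hc⟩ := exists_deriv_eq_slope Real.sinh hr
    Real.continuous_sinh.continuousOn Real.differentiable_sinh.differentiableOn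
  rw [Real.deriv_sinh, Real.sinh_zero, sub_zero, sub_zero, eq_div_iff hr.ne'] at hc
  have hle : Real.cosh c ≤ Real.cosh r := by
    rw [Real.cosh_le_cosh, abs_of_pos hc0, abs_of_pos hr]
    exact hcr.le
  nlinarith

lemma one_le_self_mul_cothR {r : ℝ} (hr : 0 < r) : 1 ≤ r * cothR r := by
  rw [cothR, ← mul_div_assoc, one_le_div (Real.sinh_pos_iff.2 hr)]
  exact sinh_le_self_mul_cosh hr

lemma continuousOn_div_jap {α : ℝ → ℝ} (hα : ContinuousOn α (Ici 0)) :
    ContinuousOn (fun y => α y / jap y) (Ici 0) :=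
  hα.div continuous_jap.continuousOn fun y _ => (jap_pos y).ne'

lemma intervalIntegrable_div_jap {α : ℝ → ℝ} (hα : ContinuousOn α (Ici 0)) {x : ℝ}
    (hx : 0 ≤ x) : IntervalIntegrable (fun y => α y / jap y) volume 0 x := by
  refine ((continuousOn_div_jap hα).mono ?_).intervalIntegrable
  rw [uIcc_of_le hx]
  exact Icc_subset_Ici_self

lemma hasDerivAt_betaHigh {α : ℝ → ℝ} (hα : ContinuousOn α (Ici 0)) {s δ r : ℝ}
    (hs : 0 < s) (hδ : 0 < δ) (hr : 0 < r) :
    HasDerivAt (betaHigh α δ s)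
      (δ * (α (δ * r / Real.sqrt s) / jap (δ * r / Real.sqrt s))) r := by
  have hsq : 0 < Real.sqrt s := Real.sqrt_pos.2 hs
  have hx : 0 < δ * r / Real.sqrt s := by positivity
  have hf := continuousOn_div_jap hα
  have hint := intervalIntegral.integral_hasDerivAt_right
    (intervalIntegrable_div_jap hα hx.le)
    ((hf.mono Ioi_subset_Ici_self).stronglyMeasurableAtFilter isOpen_Ioi _ hx)
    (hf.continuousAt (Ici_mem_nhds hx))
  have hlin : HasDerivAt (fun r => δ * r / Real.sqrt s) (δ / Real.sqrt s) r := by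
    simpa using ((hasDerivAt_id r).const_mul δ).div_const (Real.sqrt s)
  refine ((hint.comp r hlin).const_mul (Real.sqrt s)).congr_deriv ?_
  rw [mul_left_comm, mul_div_cancel₀ _ hsq.ne', mul_comm]

lemma le_betaHigh {α : ℝ → ℝ} (hα : ContinuousOn α (Ici 0))
    (hmono : AntitoneOn (fun y => α y / jap y) (Ici 0)) {s δ r : ℝ}
    (hs : 0 < s) (hδ : 0 < δ) (hr : 0 < r) :
    δ * r * (α (δ * r / Real.sqrt s) / jap (δ * r / Real.sqrt s)) ≤ betaHigh α δ s r := by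
  have hsq : 0 < Real.sqrt s := Real.sqrt_pos.2 hs
  have hx : 0 < δ * r / Real.sqrt s := by positivity
  have hle := intervalIntegral.integral_mono_on hx.le intervalIntegrable_const
    (intervalIntegrable_div_jap hα hx.le)
    fun y hy => hmono (mem_Ici.2 hy.1) (mem_Ici.2 hx.le) hy.2
  rw [intervalIntegral.integral_const, sub_zero, smul_eq_mul] at hle
  refine le_trans (le_of_eq ?_) (mul_le_mul_of_nonneg_left hle hsq.le)
  rw [← mul_assoc, mul_div_cancel₀ _ hsq.ne']

/-- **Monotonicity properties of the high-frequency multiplier weight**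
(Lemma 6.2, inequalities (6.4) and (6.5)): if `α : [0,∞) → (0,∞)` is smooth and
`y ↦ α(y)/⟨y⟩` is nonincreasing, then for all `s, δ, r > 0`:
`β_s(r) coth(r) − ∂_r β_s(r) ≥ 0`, and for each fixed `r > 0` the function
`s ↦ ∂_r β_s(r)` is nondecreasing on `(0,∞)` (i.e. `∂_s ∂_r β_s(r) ≥ 0`). -/
theorem high_freq_weight_monotonicity (α : ℝ → ℝ)
    (hα_smooth : ContDiffOn ℝ (⊤ : ℕ∞) α (Ici (0 : ℝ)))
    (hα_pos : ∀ y ∈ Ici (0 : ℝ), 0 < α y)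
    (hα_mono : AntitoneOn (fun y => α y / jap y) (Ici (0 : ℝ)))
    (s δ r : ℝ) (hs : 0 < s) (hδ : 0 < δ) (hr : 0 < r) :
    betaHigh α δ s r * cothR r - deriv (betaHigh α δ s) r ≥ 0 ∧
    MonotoneOn (fun s' => deriv (betaHigh α δ s') r) (Ioi (0 : ℝ)) := by
  have hα := hα_smooth.continuousOn
  constructor
  · rw [(hasDerivAt_betaHigh hα hs hδ hr).deriv]
    have hx : 0 ≤ δ * r / Real.sqrt s := by positivity
    have hf := div_pos (hα_pos _ hx) (jap_pos (δ * r / Real.sqrt s))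
    have hβ := le_betaHigh hα hα_mono hs hδ hr
    have hcoth : 0 ≤ cothR r :=
      div_nonneg (Real.cosh_pos r).le (Real.sinh_pos_iff.2 hr).le
    have h₁ := mul_le_mul_of_nonneg_right hβ hcoth
    have h₂ := mul_le_mul_of_nonneg_left (one_le_self_mul_cothR hr) (mul_pos hδ hf).le
    linarith
  · intro a ha b hb hab
    simp only [mem_Ioi] at ha hb
    simp only [(hasDerivAt_betaHigh hα ha hδ hr).deriv, (hasDerivAt_betaHigh hα hb hδ hr).deriv]
    have hsqa : 0 < Real.sqrt a := Real.sqrt_pos.2 ha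
    refine mul_le_mul_of_nonneg_left (hα_mono ?_ ?_ ?_) hδ.le
    · exact mem_Ici.2 (by positivity)
    · exact mem_Ici.2 (by positivity)
    · gcongr
end

section
/- Supremum characterization over slowly varying sequences (sequence form of Lemma 2.9): for every η ∈ (0,1) there exists c = c(η) ∈ (0,1] such that for every bounded sequence b : ℕ → [0,∞), c · (sup_{ℓ} b_ℓ)² ≤ sup_{α ∈ 𝒜_η} ∑_{ℓ≥0} α_ℓ b_ℓ² ≤ (sup_{ℓ} b_ℓ)². (For each α ∈ 𝒜_η the series ∑_{ℓ} α_ℓ b_ℓ² converges, since b is bounded and ∑ α_ℓ = 1.) -/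
/-- A slowly varying sequence with parameter `η`: a positive sequence summing to
`1` whose consecutive ratios lie in `[2^{−η}, 2^{η}]`. -/
def SlowlyVarying (η : ℝ) (α : ℕ → ℝ) : Prop :=
  (∀ ℓ, 0 < α ℓ) ∧ (∑' ℓ, α ℓ) = 1 ∧
    ∀ ℓ, (2 : ℝ) ^ (-η) ≤ α (ℓ + 1) / α ℓ ∧ α (ℓ + 1) / α ℓ ≤ (2 : ℝ) ^ η

/-- The two-sided geometric weight `r ^ |ℓ - k|` centred at `k`. -/
def centeredGeometric (r : ℝ) (k ℓ : ℕ) : ℝ := r ^ ((ℓ - k) + (k - ℓ))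

theorem hasSum_centeredGeometric {r : ℝ} (h0 : 0 ≤ r) (h1 : r < 1) (k : ℕ) :
    HasSum (centeredGeometric r k) ((1 - r)⁻¹ + ∑ j ∈ Finset.range k, r ^ (j + 1)) := by
  induction k with
  | zero =>
    have h : centeredGeometric r 0 = fun ℓ => r ^ ℓ := by
      funext ℓ
      simp [centeredGeometric]
    simpa [h] using hasSum_geometric_of_lt_one h0 h1
  | succ k ih =>
    have hshift : (fun ℓ => centeredGeometric r (k + 1) (ℓ + 1)) = centeredGeometric r k := by
      funext ℓ
      simp only [centeredGeometric, Nat.add_sub_add_right]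
    have hzero : centeredGeometric r (k + 1) 0 = r ^ (k + 1) := by simp [centeredGeometric]
    rw [← hasSum_nat_add_iff' 1, hshift, Finset.sum_range_one, hzero, Finset.sum_range_succ,
      ← add_assoc, add_sub_cancel_right]
    exact ih

theorem tsum_centeredGeometric_le {r : ℝ} (h0 : 0 ≤ r) (h1 : r < 1) (k : ℕ) :
    ∑' ℓ, centeredGeometric r k ℓ ≤ 2 / (1 - r) := by
  rw [(hasSum_centeredGeometric h0 h1 k).tsum_eq]
  have hle : ∑ j ∈ Finset.range k, r ^ (j + 1) ≤ (1 - r)⁻¹ :=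
    calc ∑ j ∈ Finset.range k, r ^ (j + 1) ≤ ∑ j ∈ Finset.range k, r ^ j :=
          Finset.sum_le_sum fun j _ => pow_le_pow_of_le_one h0 h1.le j.le_succ
      _ ≤ ∑' j, r ^ j :=
          (summable_geometric_of_lt_one h0 h1).sum_le_tsum _ fun j _ => pow_nonneg h0 j
      _ = (1 - r)⁻¹ := tsum_geometric_of_lt_one h0 h1
  rw [div_eq_mul_inv]
  linarith

theorem centeredGeometric_succ_div {r : ℝ} (h0 : 0 < r) (k ℓ : ℕ) :
    centeredGeometric r k (ℓ + 1) / centeredGeometric r k ℓ = r ∨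
      centeredGeometric r k (ℓ + 1) / centeredGeometric r k ℓ = r⁻¹ := by
  unfold centeredGeometric
  rcases le_or_gt k ℓ with h | h
  · left
    rw [show ℓ + 1 - k + (k - (ℓ + 1)) = (ℓ - k + (k - ℓ)) + 1 by omega, pow_succ]
    field_simp
  · right
    rw [show ℓ - k + (k - ℓ) = (ℓ + 1 - k + (k - (ℓ + 1))) + 1 by omega, pow_succ]
    field_simp

/-- Normalised two-sided geometric weights are slowly varying. -/
theorem slowlyVarying_centeredGeometric {η : ℝ} (hη : 0 < η) (k : ℕ) :
    SlowlyVarying η fun ℓ => centeredGeometric (2 ^ (-η)) k ℓ /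
      ∑' m, centeredGeometric (2 ^ (-η)) k m := by
  have h0 : (0 : ℝ) < 2 ^ (-η) := by positivity
  have h1 : (2 : ℝ) ^ (-η) < 1 := Real.rpow_lt_one_of_one_lt_of_neg one_lt_two (by linarith)
  have hpos : ∀ ℓ, 0 < centeredGeometric (2 ^ (-η)) k ℓ := fun ℓ => pow_pos h0 _
  have hZ : 0 < ∑' m, centeredGeometric (2 ^ (-η)) k m :=
    (hasSum_centeredGeometric h0.le h1 k).summable.tsum_pos (fun ℓ => (hpos ℓ).le) k (hpos k)
  have hle : (2 : ℝ) ^ (-η) ≤ 2 ^ η :=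
    Real.rpow_le_rpow_of_exponent_le one_le_two (by linarith)
  refine ⟨fun ℓ => div_pos (hpos ℓ) hZ, ?_, fun ℓ => ?_⟩
  · rw [tsum_div_const, div_self hZ.ne']
  · rw [div_div_div_cancel_right₀ hZ.ne']
    rcases centeredGeometric_succ_div h0 k ℓ with h | h <;> rw [h]
    · exact ⟨le_rfl, hle⟩
    · rw [← Real.rpow_neg zero_le_two, neg_neg]
      exact ⟨hle, le_rfl⟩

theorem SlowlyVarying.summable {η : ℝ} {α : ℕ → ℝ} (h : SlowlyVarying η α) : Summable α := by
  by_contra hs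
  simpa [tsum_eq_zero_of_not_summable hs] using h.2.1

theorem SlowlyVarying.summable_mul {η M : ℝ} {α f : ℕ → ℝ} (h : SlowlyVarying η α)
    (hf0 : ∀ ℓ, 0 ≤ f ℓ) (hfM : ∀ ℓ, f ℓ ≤ M) : Summable fun ℓ => α ℓ * f ℓ :=
  (h.summable.mul_right M).of_nonneg_of_le (fun ℓ => mul_nonneg (h.1 ℓ).le (hf0 ℓ))
    fun ℓ => mul_le_mul_of_nonneg_left (hfM ℓ) (h.1 ℓ).le

theorem SlowlyVarying.tsum_mul_le {η M : ℝ} {α f : ℕ → ℝ} (h : SlowlyVarying η α)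
    (hf0 : ∀ ℓ, 0 ≤ f ℓ) (hfM : ∀ ℓ, f ℓ ≤ M) : ∑' ℓ, α ℓ * f ℓ ≤ M :=
  calc ∑' ℓ, α ℓ * f ℓ ≤ ∑' ℓ, α ℓ * M :=
        (h.summable_mul hf0 hfM).tsum_le_tsum
          (fun ℓ => mul_le_mul_of_nonneg_left (hfM ℓ) (h.1 ℓ).le) (h.summable.mul_right M)
    _ = M := by rw [tsum_mul_right, h.2.1, one_mul]

/-- **Supremum characterization over slowly varying sequences** (sequence form of
Lemma 2.9): for every `η ∈ (0,1)` there exists `c = c(η) ∈ (0,1]` such that for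
every bounded sequence `b : ℕ → [0,∞)`,
`c (sup_ℓ b_ℓ)² ≤ sup_{α ∈ 𝒜_η} ∑_ℓ α_ℓ b_ℓ² ≤ (sup_ℓ b_ℓ)²`. -/
theorem slowly_varying_sup_characterization (η : ℝ) (hη0 : 0 < η) (hη1 : η < 1) :
    ∃ c : ℝ, 0 < c ∧ c ≤ 1 ∧
      ∀ b : ℕ → ℝ, (∀ ℓ, 0 ≤ b ℓ) → BddAbove (Set.range b) →
        c * (⨆ ℓ, b ℓ) ^ 2
            ≤ (⨆ α : {a : ℕ → ℝ // SlowlyVarying η a}, ∑' ℓ, α.1 ℓ * b ℓ ^ 2)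
        ∧ (⨆ α : {a : ℕ → ℝ // SlowlyVarying η a}, ∑' ℓ, α.1 ℓ * b ℓ ^ 2)
            ≤ (⨆ ℓ, b ℓ) ^ 2 := by
  have h0 : (0 : ℝ) < 2 ^ (-η) := by positivity
  have h1 : (2 : ℝ) ^ (-η) < 1 := Real.rpow_lt_one_of_one_lt_of_neg one_lt_two (by linarith)
  have hc : 0 < (1 - (2 : ℝ) ^ (-η)) / 2 := by linarith
  refine ⟨(1 - 2 ^ (-η)) / 2, hc, by linarith, fun b hb hbdd => ?_⟩
  have hsq : ∀ ℓ, b ℓ ^ 2 ≤ (⨆ ℓ, b ℓ) ^ 2 := fun ℓ =>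
    pow_le_pow_left₀ (hb ℓ) (le_ciSup hbdd ℓ) 2
  have hsq0 : ∀ ℓ, 0 ≤ b ℓ ^ 2 := fun ℓ => sq_nonneg (b ℓ)
  have hupper : ∀ α : {a : ℕ → ℝ // SlowlyVarying η a},
      ∑' ℓ, α.1 ℓ * b ℓ ^ 2 ≤ (⨆ ℓ, b ℓ) ^ 2 := fun α => α.2.tsum_mul_le hsq0 hsq
  have : Nonempty {a : ℕ → ℝ // SlowlyVarying η a} :=
    ⟨⟨_, slowlyVarying_centeredGeometric hη0 0⟩⟩
  refine ⟨?_, ciSup_le hupper⟩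
  set S := ⨆ α : {a : ℕ → ℝ // SlowlyVarying η a}, ∑' ℓ, α.1 ℓ * b ℓ ^ 2
  have hlower : ∀ k, (1 - (2 : ℝ) ^ (-η)) / 2 * b k ^ 2 ≤ S := by
    intro k
    have hα := slowlyVarying_centeredGeometric hη0 k
    have hZ := tsum_centeredGeometric_le h0.le h1 k
    have hαk := hα.1 k
    simp only [centeredGeometric, Nat.sub_self, add_zero, pow_zero] at hαk
    have hcα : (1 - (2 : ℝ) ^ (-η)) / 2 ≤ centeredGeometric (2 ^ (-η)) k k /
        ∑' m, centeredGeometric (2 ^ (-η)) k m := by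
      have := one_div_le_one_div_of_le (one_div_pos.mp hαk) hZ
      rw [one_div_div] at this
      simpa [centeredGeometric] using this
    calc _ ≤ centeredGeometric (2 ^ (-η)) k k /
          (∑' m, centeredGeometric (2 ^ (-η)) k m) * b k ^ 2 :=
          mul_le_mul_of_nonneg_right hcα (hsq0 k)
      _ ≤ _ := (hα.summable_mul hsq0 hsq).le_tsum k
          fun ℓ _ => mul_nonneg (hα.1 ℓ).le (hsq0 ℓ)
      _ ≤ S := le_ciSup (f := fun α : {a : ℕ → ℝ // SlowlyVarying η a} =>
          ∑' ℓ, α.1 ℓ * b ℓ ^ 2) ⟨_, Set.forall_mem_range.mpr hupper⟩ ⟨_, hα⟩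
  have hsup : (⨆ ℓ, b ℓ) ≤ √(S / ((1 - 2 ^ (-η)) / 2)) :=
    ciSup_le fun k => Real.le_sqrt_of_sq_le ((le_div_iff₀' hc).mpr (hlower k))
  have hS : 0 ≤ S := (mul_nonneg hc.le (hsq0 0)).trans (hlower 0)
  rw [← le_div_iff₀' hc]
  exact (pow_le_pow_left₀ (Real.iSup_nonneg hb) hsup 2).trans_eq
    (Real.sq_sqrt (div_nonneg hS hc.le))
end
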